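/- For every n ≥ 1 there exist R-linear maps ε_n : W_{n,R} → W_{n−1,R} and ε : W_{n,R} → R such that: (i) ε_n(ι(a)·x·ι(b)) = a·ε_n(x)·b for all a, b ∈ W_{n−1,R} and x ∈ W_{n,R}, where ι : W_{n−1,R} → W_{n,R} is the canonical homomorphism g_i ↦ g_i, e_i ↦ e_i; (ii) ε_n ∘ ι = id on W_{n−1,R}, so in particular ι is injective; (iii) in W_{n+1,R}, e_n·ι(x)·e_n = δ·ι′(ε_n(x))·e_n for all x ∈ W_{n,R}, where ι and ι′ denote the canonical homomorphisms of W_{n,R} and W_{n−1,R} into W_{n+1,R}; (iv) ε is a trace, i.e. ε(xy) = ε(yx) for all x, y ∈ W_{n,R}, with ε(1) = 1; (v) ε ∘ ι equals the corresponding trace on W_{n−1,R}. -/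

import Mathlib

namespace BMW

/-- Generators of the Birman–Wenzl–Murakami algebra `W_{n,R}`:
`g i`, `g i`⁻¹ and `e i` for `1 ≤ i ≤ n - 1`. -/
inductive Gen (n : ℕ) : Type where
  | g (i : ℕ) (h : 1 ≤ i ∧ i < n) : Gen n
  | gi (i : ℕ) (h : 1 ≤ i ∧ i < n) : Gen n
  | e (i : ℕ) (h : 1 ≤ i ∧ i < n) : Gen n

variable (R : Type*) [CommRing R]

/-- The generator `g i` in the free algebra (junk value `1` if `i` is out of range). -/
noncomputable def FG (n i : ℕ) : FreeAlgebra R (Gen n) :=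
  if h : 1 ≤ i ∧ i < n then FreeAlgebra.ι R (Gen.g i h) else 1

/-- The generator `g i⁻¹` in the free algebra (junk value `1` if `i` is out of range). -/
noncomputable def FGi (n i : ℕ) : FreeAlgebra R (Gen n) :=
  if h : 1 ≤ i ∧ i < n then FreeAlgebra.ι R (Gen.gi i h) else 1

/-- The generator `e i` in the free algebra (junk value `1` if `i` is out of range). -/
noncomputable def FE (n i : ℕ) : FreeAlgebra R (Gen n) :=
  if h : 1 ≤ i ∧ i < n then FreeAlgebra.ι R (Gen.e i h) else 1

/-- The defining relations of the Birman–Wenzl–Murakami algebra `W_{n,R}`. -/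
inductive Rel (lam laminv del z : R) (n : ℕ) :
    FreeAlgebra R (Gen n) → FreeAlgebra R (Gen n) → Prop where
  | inv_right (i : ℕ) (h : 1 ≤ i ∧ i < n) :
      Rel lam laminv del z n (FG R n i * FGi R n i) 1
  | inv_left (i : ℕ) (h : 1 ≤ i ∧ i < n) :
      Rel lam laminv del z n (FGi R n i * FG R n i) 1
  | idem (i : ℕ) (h : 1 ≤ i ∧ i < n) :
      Rel lam laminv del z n (FE R n i * FE R n i) (del • FE R n i)
  | braid (i : ℕ) (h : 1 ≤ i ∧ i + 1 < n) :
      Rel lam laminv del z n (FG R n i * FG R n (i + 1) * FG R n i)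
        (FG R n (i + 1) * FG R n i * FG R n (i + 1))
  | comm_gg (i j : ℕ) (h : 1 ≤ i ∧ 1 ≤ j ∧ i < n ∧ j < n ∧ (i + 2 ≤ j ∨ j + 2 ≤ i)) :
      Rel lam laminv del z n (FG R n i * FG R n j) (FG R n j * FG R n i)
  | comm_ge (i j : ℕ) (h : 1 ≤ i ∧ 1 ≤ j ∧ i < n ∧ j < n ∧ (i + 2 ≤ j ∨ j + 2 ≤ i)) :
      Rel lam laminv del z n (FG R n i * FE R n j) (FE R n j * FG R n i)
  | comm_ee (i j : ℕ) (h : 1 ≤ i ∧ 1 ≤ j ∧ i < n ∧ j < n ∧ (i + 2 ≤ j ∨ j + 2 ≤ i)) :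
      Rel lam laminv del z n (FE R n i * FE R n j) (FE R n j * FE R n i)
  | tangle_eee_up (i : ℕ) (h : 1 ≤ i ∧ i + 1 < n) :
      Rel lam laminv del z n (FE R n i * FE R n (i + 1) * FE R n i) (FE R n i)
  | tangle_eee_down (i : ℕ) (h : 1 ≤ i ∧ i + 1 < n) :
      Rel lam laminv del z n (FE R n (i + 1) * FE R n i * FE R n (i + 1)) (FE R n (i + 1))
  | tangle_gge_up (i : ℕ) (h : 1 ≤ i ∧ i + 1 < n) :
      Rel lam laminv del z n (FG R n i * FG R n (i + 1) * FE R n i)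
        (FE R n (i + 1) * FE R n i)
  | tangle_gge_down (i : ℕ) (h : 1 ≤ i ∧ i + 1 < n) :
      Rel lam laminv del z n (FG R n (i + 1) * FG R n i * FE R n (i + 1))
        (FE R n i * FE R n (i + 1))
  | tangle_egg_up (i : ℕ) (h : 1 ≤ i ∧ i + 1 < n) :
      Rel lam laminv del z n (FE R n i * FG R n (i + 1) * FG R n i)
        (FE R n i * FE R n (i + 1))
  | tangle_egg_down (i : ℕ) (h : 1 ≤ i ∧ i + 1 < n) :
      Rel lam laminv del z n (FE R n (i + 1) * FG R n i * FG R n (i + 1))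
        (FE R n (i + 1) * FE R n i)
  | skein (i : ℕ) (h : 1 ≤ i ∧ i < n) :
      Rel lam laminv del z n (FG R n i - FGi R n i) (z • (FE R n i - 1))
  | untwist_ge (i : ℕ) (h : 1 ≤ i ∧ i < n) :
      Rel lam laminv del z n (FG R n i * FE R n i) (laminv • FE R n i)
  | untwist_eg (i : ℕ) (h : 1 ≤ i ∧ i < n) :
      Rel lam laminv del z n (FE R n i * FG R n i) (laminv • FE R n i)
  | untwist_ege_up (i : ℕ) (h : 1 ≤ i ∧ i + 1 < n) :
      Rel lam laminv del z n (FE R n i * FG R n (i + 1) * FE R n i) (lam • FE R n i)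
  | untwist_ege_down (i : ℕ) (h : 1 ≤ i ∧ i + 1 < n) :
      Rel lam laminv del z n (FE R n (i + 1) * FG R n i * FE R n (i + 1))
        (lam • FE R n (i + 1))

/-- The Birman–Wenzl–Murakami algebra `W_{n,R}`, presented by generators and relations. -/
abbrev Alg (lam laminv del z : R) (n : ℕ) : Type _ :=
  RingQuot (Rel R lam laminv del z n)

variable (lam laminv del z : R) (n : ℕ)

/-- The generator `g i` of `W_{n,R}`. -/
noncomputable def g (i : ℕ) : Alg R lam laminv del z n :=
  RingQuot.mkAlgHom R (Rel R lam laminv del z n) (FG R n i)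

/-- The generator `g i⁻¹` of `W_{n,R}`. -/
noncomputable def gi (i : ℕ) : Alg R lam laminv del z n :=
  RingQuot.mkAlgHom R (Rel R lam laminv del z n) (FGi R n i)

/-- The generator `e i` of `W_{n,R}`. -/
noncomputable def e (i : ℕ) : Alg R lam laminv del z n :=
  RingQuot.mkAlgHom R (Rel R lam laminv del z n) (FE R n i)

end BMW

namespace BMW

universe u

section BasicConstruction

open scoped TensorProduct RightActions

section PresentedBimodule

variable {R A B : Type*} [CommRing R] [Ring A] [Algebra R A] [Ring B] [Algebra R B]

/-- The relations between the three generators of the bimodule `PresBimod`. -/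
inductive BimodRel (ι : B →ₐ[R] A) (gi e : A) :
    (A ⊗[R] Aᵐᵒᵖ) × (A ⊗[R] Aᵐᵒᵖ) × (A ⊗[R] Aᵐᵒᵖ) →
    (A ⊗[R] Aᵐᵒᵖ) × (A ⊗[R] Aᵐᵒᵖ) × (A ⊗[R] Aᵐᵒᵖ) → Prop where
  | central (a : A) : BimodRel ι gi e (a ⊗ₜ 1, 0, 0) (1 ⊗ₜ MulOpposite.op a, 0, 0)
  | comm_g (b : B) : BimodRel ι gi e (0, ι b ⊗ₜ 1, 0) (0, 1 ⊗ₜ MulOpposite.op (ι b), 0)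
  | comm_e (b : B) : BimodRel ι gi e (0, 0, ι b ⊗ₜ 1) (0, 0, 1 ⊗ₜ MulOpposite.op (ι b))
  | right : BimodRel ι gi e (0, 1 ⊗ₜ MulOpposite.op e, 0) (0, 0, gi ⊗ₜ MulOpposite.op e)
  | left : BimodRel ι gi e (0, e ⊗ₜ 1, 0) (0, 0, e ⊗ₜ MulOpposite.op gi)
  | both : BimodRel ι gi e (0, 0, e ⊗ₜ MulOpposite.op e) (e ⊗ₜ 1, 0, 0)

/-- The `A`-bimodule with generators `one`, `gen`, `cup`, where `one` is central, `gen` and `cup`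
commute with the image of `B`, and `gen <• e = gi • cup <• e`, `e • gen = e • cup <• gi`,
`e • cup <• e = e • one`. -/
def PresBimod (ι : B →ₐ[R] A) (gi e : A) : Type _ :=
  ((A ⊗[R] Aᵐᵒᵖ) × (A ⊗[R] Aᵐᵒᵖ) × (A ⊗[R] Aᵐᵒᵖ)) ⧸
    Submodule.span (A ⊗[R] Aᵐᵒᵖ) {x | ∃ p q, BimodRel ι gi e p q ∧ x = p - q}

namespace PresBimod

variable (ι : B →ₐ[R] A) (gi e : A)

noncomputable instance : AddCommGroup (PresBimod ι gi e) :=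
  inferInstanceAs (AddCommGroup (_ ⧸ Submodule.span (A ⊗[R] Aᵐᵒᵖ) {x | ∃ p q,
      BimodRel ι gi e p q ∧ x = p - q}))

noncomputable instance : Module (A ⊗[R] Aᵐᵒᵖ) (PresBimod ι gi e) :=
  inferInstanceAs (Module _ (_ ⧸ Submodule.span (A ⊗[R] Aᵐᵒᵖ) {x | ∃ p q,
      BimodRel ι gi e p q ∧ x = p - q}))

noncomputable instance : Module R (PresBimod ι gi e) :=
  inferInstanceAs (Module R (_ ⧸ Submodule.span (A ⊗[R] Aᵐᵒᵖ) {x | ∃ p q,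
      BimodRel ι gi e p q ∧ x = p - q}))

instance : IsScalarTower R (A ⊗[R] Aᵐᵒᵖ) (PresBimod ι gi e) :=
  inferInstanceAs (IsScalarTower R _ (_ ⧸ Submodule.span (A ⊗[R] Aᵐᵒᵖ) {x | ∃ p q,
      BimodRel ι gi e p q ∧ x = p - q}))

noncomputable instance : Module A (PresBimod ι gi e) :=
  Module.compHom _ (Algebra.TensorProduct.includeLeft : A →ₐ[R] A ⊗[R] Aᵐᵒᵖ).toRingHom

noncomputable instance : Module Aᵐᵒᵖ (PresBimod ι gi e) :=
  Module.compHom _ (Algebra.TensorProduct.includeRight : Aᵐᵒᵖ →ₐ[R] A ⊗[R] Aᵐᵒᵖ).toRingHom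

variable {ι gi e}

theorem left_smul_def (a : A) (x : PresBimod ι gi e) :
    a • x = (a ⊗ₜ[R] (1 : Aᵐᵒᵖ)) • x := rfl

theorem right_smul_def (b : Aᵐᵒᵖ) (x : PresBimod ι gi e) :
    b • x = ((1 : A) ⊗ₜ[R] b) • x := rfl

instance : SMulCommClass A Aᵐᵒᵖ (PresBimod ι gi e) where
  smul_comm a b x := by simp [left_smul_def, right_smul_def, smul_smul]

instance : IsScalarTower R A (PresBimod ι gi e) where
  smul_assoc r a x := by
    simp only [left_smul_def]
    rw [← smul_assoc, TensorProduct.smul_tmul']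

instance : IsScalarTower R Aᵐᵒᵖ (PresBimod ι gi e) where
  smul_assoc r a x := by
    simp only [right_smul_def]
    rw [← smul_assoc, TensorProduct.tmul_smul]

variable (ι gi e)

/-- The projection from the free bimodule on three generators. -/
noncomputable def mk : ((A ⊗[R] Aᵐᵒᵖ) × (A ⊗[R] Aᵐᵒᵖ) × (A ⊗[R] Aᵐᵒᵖ)) →ₗ[A ⊗[R] Aᵐᵒᵖ]
    PresBimod ι gi e :=
  Submodule.mkQ _

/-- The central generator of the presented bimodule. -/
noncomputable def one : PresBimod ι gi e := mk ι gi e (1, 0, 0)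

/-- The generator of the presented bimodule corresponding to a braid generator. -/
noncomputable def gen : PresBimod ι gi e := mk ι gi e (0, 1, 0)

/-- The generator of the presented bimodule corresponding to a tangle generator. -/
noncomputable def cup : PresBimod ι gi e := mk ι gi e (0, 0, 1)

variable {ι gi e}

theorem mk_eq {p q} (h : BimodRel ι gi e p q) : mk ι gi e p = mk ι gi e q := by
  rw [← sub_eq_zero, ← map_sub]
  exact (Submodule.Quotient.mk_eq_zero _).2 (Submodule.subset_span ⟨p, q, h, rfl⟩)

theorem mk_fst (x : A ⊗[R] Aᵐᵒᵖ) : mk ι gi e (x, 0, 0) = x • one ι gi e := by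
  simp only [one, ← map_smul]
  simp

theorem mk_snd (x : A ⊗[R] Aᵐᵒᵖ) : mk ι gi e (0, x, 0) = x • gen ι gi e := by
  simp only [gen, ← map_smul]
  simp

theorem mk_trd (x : A ⊗[R] Aᵐᵒᵖ) : mk ι gi e (0, 0, x) = x • cup ι gi e := by
  simp only [cup, ← map_smul]
  simp

theorem mk_apply (x y w : A ⊗[R] Aᵐᵒᵖ) :
    mk ι gi e (x, y, w) = x • one ι gi e + y • gen ι gi e + w • cup ι gi e := by
  rw [← mk_fst, ← mk_snd, ← mk_trd, ← map_add, ← map_add]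
  simp

theorem tmul_smul_eq (a : A) (b : Aᵐᵒᵖ) (x : PresBimod ι gi e) :
    (a ⊗ₜ[R] b) • x = a • b • x := by
  simp [left_smul_def, right_smul_def, smul_smul]

theorem smul_one_eq (a : A) : a • one ι gi e = one ι gi e <• a := by
  simpa [mk_fst, tmul_smul_eq] using mk_eq (BimodRel.central (ι := ι) (gi := gi) (e := e) a)

theorem smul_gen (b : B) : ι b • gen ι gi e = gen ι gi e <• ι b := by
  simpa [mk_snd, tmul_smul_eq] using mk_eq (BimodRel.comm_g (ι := ι) (gi := gi) (e := e) b)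

theorem smul_cup (b : B) : ι b • cup ι gi e = cup ι gi e <• ι b := by
  simpa [mk_trd, tmul_smul_eq] using mk_eq (BimodRel.comm_e (ι := ι) (gi := gi) (e := e) b)

theorem gen_right : gen ι gi e <• e = gi • (cup ι gi e <• e) := by
  simpa [mk_snd, mk_trd, tmul_smul_eq] using
    mk_eq (BimodRel.right (ι := ι) (gi := gi) (e := e))

theorem left_gen : e • gen ι gi e = e • (cup ι gi e <• gi) := by
  simpa [mk_snd, mk_trd, tmul_smul_eq] using
    mk_eq (BimodRel.left (ι := ι) (gi := gi) (e := e))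

theorem both_cup : e • (cup ι gi e <• e) = e • one ι gi e := by
  simpa [mk_fst, mk_trd, tmul_smul_eq] using
    mk_eq (BimodRel.both (ι := ι) (gi := gi) (e := e))

section Lift

variable {Y : Type*} [AddCommGroup Y] [Module R Y]

/-- Auxiliary: the linear map `a ⊗ b ↦ f a · b`. -/
noncomputable def preLift (Q : Aᵐᵒᵖ →ₐ[R] Module.End R Y) (f : A →ₗ[R] Y) :
    (A ⊗[R] Aᵐᵒᵖ) →ₗ[R] Y :=
  TensorProduct.lift (Q.toLinearMap.flip ∘ₗ f)

@[simp] theorem preLift_tmul (Q : Aᵐᵒᵖ →ₐ[R] Module.End R Y) (f : A →ₗ[R] Y) (a : A) (b : Aᵐᵒᵖ) :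
    preLift Q f (a ⊗ₜ b) = Q b (f a) := by
  simp [preLift]

theorem exists_lift (Q : Aᵐᵒᵖ →ₐ[R] Module.End R Y) (f₁ f₂ f₃ : A →ₗ[R] Y)
    (h₁ : ∀ x a, f₁ (x * a) = Q (MulOpposite.op a) (f₁ x))
    (h₂ : ∀ x b, f₂ (x * ι b) = Q (MulOpposite.op (ι b)) (f₂ x))
    (h₃ : ∀ x b, f₃ (x * ι b) = Q (MulOpposite.op (ι b)) (f₃ x))
    (h_right : ∀ x, Q (MulOpposite.op e) (f₂ x) = Q (MulOpposite.op e) (f₃ (x * gi)))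
    (h_left : ∀ x, f₂ (x * e) = Q (MulOpposite.op gi) (f₃ (x * e)))
    (h_both : ∀ x, Q (MulOpposite.op e) (f₃ (x * e)) = f₁ (x * e)) :
    ∃ F : PresBimod ι gi e →ₗ[R] Y,
      (∀ x b, F (x <• b) = Q (MulOpposite.op b) (F x)) ∧ (∀ a, F (a • one ι gi e) = f₁ a) ∧
      (∀ a, F (a • gen ι gi e) = f₂ a) ∧ ∀ a, F (a • cup ι gi e) = f₃ a := by
  let F₀ : ((A ⊗[R] Aᵐᵒᵖ) × (A ⊗[R] Aᵐᵒᵖ) × (A ⊗[R] Aᵐᵒᵖ)) →ₗ[R] Y :=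
    (preLift Q f₁).coprod ((preLift Q f₂).coprod (preLift Q f₃))
  have key : (Submodule.span (A ⊗[R] Aᵐᵒᵖ) {x | ∃ p q, BimodRel ι gi e p q ∧ x =
      p - q}).restrictScalars R
      ≤ LinearMap.ker F₀ := by
    intro r hr
    have : ∀ t : A ⊗[R] Aᵐᵒᵖ, F₀ (t • r) = 0 := by
      refine Submodule.span_induction (p := fun r _ => ∀ t : A ⊗[R] Aᵐᵒᵖ, F₀ (t • r) = 0)
        ?_ ?_ ?_ ?_ hr
      · rintro _ ⟨p, q, hr, rfl⟩ t
        rw [smul_sub, map_sub, sub_eq_zero]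
        have tmul : ∀ (x : A) (y : Aᵐᵒᵖ), F₀ ((x ⊗ₜ[R] y) • p) = F₀ ((x ⊗ₜ[R] y) • q) := by
          intro x y
          cases hr with
          | central a => simp [F₀, h₁]
          | comm_g a => simp [F₀, h₂]
          | comm_e a => simp [F₀, h₃]
          | right => simp [F₀, h_right]
          | left => simp [F₀, h_left]
          | both => simp [F₀, h_both]
        induction t with
        | zero => exact TensorProduct.zero_tmul (R := R) A (0 : Aᵐᵒᵖ) ▸ tmul 0 0
        | add t t' h h' => rw [add_smul, map_add, h, h', add_smul, map_add]
        | tmul x y => exact tmul x y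
      · simp
      · intro x y _ _ hx hy t
        rw [smul_add, map_add, hx, hy, add_zero]
      · intro s x _ hx t
        rw [smul_smul]
        exact hx _
    simpa using this 1
  let F : PresBimod ι gi e →ₗ[R] Y :=
    Submodule.liftQ ((Submodule.span (A ⊗[R] Aᵐᵒᵖ) {x | ∃ p q,
        BimodRel ι gi e p q ∧ x = p - q}).restrictScalars R)
      F₀ key
  have hF : ∀ x, F (mk ι gi e x) = F₀ x := fun x => rfl
  refine ⟨F, ?_, ?_, ?_, ?_⟩
  · intro x b
    obtain ⟨⟨x, y, w⟩, rfl⟩ := Submodule.mkQ_surjective _ x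
    change F (MulOpposite.op b • mk ι gi e _) = Q _ (F (mk ι gi e _))
    rw [right_smul_def, ← map_smul, hF, hF]
    have : ∀ (f : A →ₗ[R] Y) (x : A ⊗[R] Aᵐᵒᵖ),
        preLift Q f ((1 ⊗ₜ MulOpposite.op b) * x) = Q (MulOpposite.op b) (preLift Q f x) := by
      intro f x
      induction x with
      | zero => simp
      | add t t' h h' => rw [mul_add, map_add, h, h', map_add, map_add]
      | tmul x y => simp
    simp [F₀, this]
  · intro a
    rw [one, left_smul_def, ← map_smul, hF]
    simp [F₀, Algebra.TensorProduct.one_def]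
  · intro a
    rw [gen, left_smul_def, ← map_smul, hF]
    simp [F₀, Algebra.TensorProduct.one_def]
  · intro a
    rw [cup, left_smul_def, ← map_smul, hF]
    simp [F₀, Algebra.TensorProduct.one_def]

end Lift

@[elab_as_elim]
theorem induction_on {p : PresBimod ι gi e → Prop} (x : PresBimod ι gi e)
    (h_add : ∀ x y, p x → p y → p (x + y))
    (h_one : ∀ b : A, p (one ι gi e <• b))
    (h_gen : ∀ a b : A, p (a • gen ι gi e <• b)) (h_cup : ∀ a b : A, p (a • cup ι gi e <• b)) :
    p x := by
  have aux : ∀ (y : PresBimod ι gi e) (_ : ∀ (a : A) (b : Aᵐᵒᵖ), p ((a ⊗ₜ[R] b) • y))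
      (t : A ⊗[R] Aᵐᵒᵖ), p (t • y) := by
    intro y h t
    induction t with
    | zero => exact TensorProduct.zero_tmul (R := R) A (0 : Aᵐᵒᵖ) ▸ h 0 0
    | add t t' h h' => rw [add_smul]; exact h_add _ _ h h'
    | tmul a b => exact h a b
  obtain ⟨⟨x, y, w⟩, rfl⟩ := Submodule.mkQ_surjective _ x
  change p (mk ι gi e _)
  rw [mk_apply]
  refine h_add _ _ (h_add _ _ (aux _ ?_ x) (aux _ ?_ y)) (aux _ ?_ w)
  · intro a b
    rw [tmul_smul_eq, smul_comm, smul_one_eq, smul_smul]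
    exact h_one (a * b.unop)
  · intro a b
    rw [tmul_smul_eq]
    exact h_gen a b.unop
  · intro a b
    rw [tmul_smul_eq]
    exact h_cup a b.unop

theorem smul_right_smul (a b : A) (x : PresBimod ι gi e) : (a • x) <• b = a • (x <• b) :=
  (smul_comm a (MulOpposite.op b) x).symm

theorem scalar_right_smul (r : R) (b : A) (x : PresBimod ι gi e) : (r • x) <• b = r • (x <• b) :=
  smul_comm _ _ _

theorem gen_mul (b : B) (x : A) : gen ι gi e <• (ι b * x) = ι b • (gen ι gi e <• x) := by
  rw [← op_smul_op_smul, ← smul_gen, smul_right_smul]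

theorem cup_mul (b : B) (x : A) : cup ι gi e <• (ι b * x) = ι b • (cup ι gi e <• x) := by
  rw [← op_smul_op_smul, ← smul_cup, smul_right_smul]

theorem gen_e_mul (x : A) : gen ι gi e <• (e * x) = gi • (cup ι gi e <• (e * x)) := by
  rw [← op_smul_op_smul, gen_right, smul_right_smul, op_smul_op_smul]

theorem mul_e_smul_gen (a x : A) :
    (a * e) • (gen ι gi e <• x) = (a * e) • (cup ι gi e <• (gi * x)) := by
  rw [← smul_right_smul, mul_smul, left_gen, ← mul_smul, smul_right_smul, op_smul_op_smul]

theorem mul_e_smul_cup_e (a x : A) :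
    (a * e) • (cup ι gi e <• (e * x)) = one ι gi e <• (a * e * x) := by
  rw [← op_smul_op_smul, ← smul_right_smul, mul_smul, both_cup, ← mul_smul,
    smul_one_eq, op_smul_op_smul]

theorem smul_one_right (a x : A) : a • (one ι gi e <• x) = one ι gi e <• (a * x) := by
  rw [← smul_right_smul, smul_one_eq, op_smul_op_smul]

end PresBimod

end PresentedBimodule

section Representations

/-- The relations satisfied by the triple `g i`, `g i`⁻¹, `e i`. -/
structure Single {R : Type*} [CommRing R] (lam laminv del z : R) {S : Type*} [Ring S] [Algebra R S]
    (g gi e : S) : Prop where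
  g_gi : g * gi = 1
  gi_g : gi * g = 1
  e_e : e * e = del • e
  skein : g - gi = z • (e - 1)
  g_e : g * e = laminv • e
  e_g : e * g = laminv • e

/-- The relations satisfied by two adjacent triples of generators. -/
structure Adjacent {S : Type*} [Ring S] (g e g' e' : S) : Prop where
  braid : g * g' * g = g' * g * g'
  eee_up : e * e' * e = e
  eee_down : e' * e * e' = e'
  gge_up : g * g' * e = e' * e
  gge_down : g' * g * e' = e * e'
  egg_up : e * g' * g = e * e'
  egg_down : e' * g * g' = e' * e

theorem Adjacent.symm {S : Type*} [Ring S] {g e g' e' : S} (h : Adjacent g e g' e') :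
    Adjacent g' e' g e :=
  ⟨h.braid.symm, h.eee_down, h.eee_up, h.gge_down, h.gge_up, h.egg_down, h.egg_up⟩

/-- Families satisfying the defining relations of the Birman–Wenzl–Murakami algebra. -/
structure IsRep {R : Type*} [CommRing R] (lam laminv del z : R) (n : ℕ) {S : Type*} [Ring S]
    [Algebra R S] (G Gi E : ℕ → S) : Prop where
  single : ∀ i, 1 ≤ i → i < n → Single lam laminv del z (G i) (Gi i) (E i)
  adjacent : ∀ i, 1 ≤ i → i + 1 < n → Adjacent (G i) (E i) (G (i + 1)) (E (i + 1))
  comm_gg : ∀ i j, 1 ≤ i → i + 2 ≤ j → j < n → G i * G j = G j * G i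
  comm_ge : ∀ i j, 1 ≤ i → i + 2 ≤ j → j < n → G i * E j = E j * G i
  comm_eg : ∀ i j, 1 ≤ i → i + 2 ≤ j → j < n → E i * G j = G j * E i
  comm_ee : ∀ i j, 1 ≤ i → i + 2 ≤ j → j < n → E i * E j = E j * E i

variable {R : Type*} [CommRing R] {lam laminv del z : R} {S : Type*} [Ring S] [Algebra R S]

theorem Single.gi_e {g gi e : S} (h : Single lam laminv del z g gi e) (hlam : lam * laminv = 1) :
    gi * e = lam • e := by
  have := congrArg (fun x => lam • (gi * x)) h.g_e
  simp only [← mul_assoc, h.gi_g, mul_smul_comm, smul_smul, hlam, one_smul, one_mul] at this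
  exact this.symm

theorem Single.e_gi {g gi e : S} (h : Single lam laminv del z g gi e) (hlam : lam * laminv = 1) :
    e * gi = lam • e := by
  have := congrArg (fun x => lam • (x * gi)) h.e_g
  simp only [mul_assoc, h.g_gi, smul_mul_assoc, smul_smul, hlam, one_smul, mul_one] at this
  exact this.symm

theorem Single.commute {g gi e : S} (h : Single lam laminv del z g gi e) {c : S}
    (hc : g * c = c * g) : gi * c = c * gi :=
  calc gi * c = gi * (c * g) * gi := by rw [mul_assoc, mul_assoc, h.g_gi, mul_one]
    _ = c * gi := by rw [← hc, ← mul_assoc, h.gi_g, one_mul]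

theorem Adjacent.ege_up {g gi e g' e' : S} (h : Single lam laminv del z g gi e)
    (hlam : lam * laminv = 1)
    (hh : Adjacent g e g' e') : e * g' * e = lam • e := by
  have h1 : e * g' = e * e' * gi := by
    rw [← hh.egg_up, mul_assoc (e * g'), h.g_gi, mul_one]
  rw [h1, mul_assoc, h.gi_e hlam, mul_smul_comm, hh.eee_up]

theorem FG_of {n i : ℕ} (h : 1 ≤ i ∧ i < n) : FG R n i = FreeAlgebra.ι R (Gen.g i h) := dif_pos h
theorem FGi_of {n i : ℕ} (h : 1 ≤ i ∧ i < n) : FGi R n i = FreeAlgebra.ι R (Gen.gi i h) :=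
  dif_pos h
theorem FE_of {n i : ℕ} (h : 1 ≤ i ∧ i < n) : FE R n i = FreeAlgebra.ι R (Gen.e i h) := dif_pos h

/-- The value of a family of triples on the generators. -/
def genValue {n : ℕ} (G Gi E : ℕ → S) : Gen n → S
  | .g i _ => G i
  | .gi i _ => Gi i
  | .e i _ => E i

theorem IsRep.exists_algHom {n : ℕ} {G Gi E : ℕ → S} (H : IsRep lam laminv del z n G Gi E)
    (hlam : lam * laminv = 1) :
    ∃ φ : Alg R lam laminv del z n →ₐ[R] S, ∀ i, 1 ≤ i → i < n →
      φ (g R lam laminv del z n i) = G i ∧ φ (gi R lam laminv del z n i) = Gi i ∧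
      φ (e R lam laminv del z n i) = E i := by
  let φ₀ : FreeAlgebra R (Gen n) →ₐ[R] S := FreeAlgebra.lift R (genValue G Gi E)
  have hG : ∀ i, 1 ≤ i ∧ i < n → φ₀ (FG R n i) = G i := fun i h => by
    rw [FG_of h, FreeAlgebra.lift_ι_apply, genValue]
  have hGi : ∀ i, 1 ≤ i ∧ i < n → φ₀ (FGi R n i) = Gi i := fun i h => by
    rw [FGi_of h, FreeAlgebra.lift_ι_apply, genValue]
  have hE : ∀ i, 1 ≤ i ∧ i < n → φ₀ (FE R n i) = E i := fun i h => by
    rw [FE_of h, FreeAlgebra.lift_ι_apply, genValue]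
  have hrel : ∀ ⦃x y⦄, Rel R lam laminv del z n x y → φ₀ x = φ₀ y := by
    intro x y hxy
    cases hxy with
    | inv_right i h => simpa [hG i h, hGi i h] using (H.single i h.1 h.2).g_gi
    | inv_left i h => simpa [hG i h, hGi i h] using (H.single i h.1 h.2).gi_g
    | idem i h => simpa [hE i h] using (H.single i h.1 h.2).e_e
    | skein i h => simpa [hG i h, hGi i h, hE i h] using (H.single i h.1 h.2).skein
    | untwist_ge i h => simpa [hG i h, hE i h] using (H.single i h.1 h.2).g_e
    | untwist_eg i h => simpa [hG i h, hE i h] using (H.single i h.1 h.2).e_g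
    | comm_gg i j h =>
      rw [map_mul, map_mul, hG i (by lia), hG j (by lia)]
      rcases h.2.2.2.2 with h' | h'
      · exact H.comm_gg i j h.1 h' (by lia)
      · exact (H.comm_gg j i (by lia) h' (by lia)).symm
    | comm_ge i j h =>
      rw [map_mul, map_mul, hG i (by lia), hE j (by lia)]
      rcases h.2.2.2.2 with h' | h'
      · exact H.comm_ge i j h.1 h' (by lia)
      · exact (H.comm_eg j i (by lia) h' (by lia)).symm
    | comm_ee i j h =>
      rw [map_mul, map_mul, hE i (by lia), hE j (by lia)]
      rcases h.2.2.2.2 with h' | h'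
      · exact H.comm_ee i j h.1 h' (by lia)
      · exact (H.comm_ee j i (by lia) h' (by lia)).symm
    | braid i h | tangle_eee_up i h | tangle_eee_down i h | tangle_gge_up i h
    | tangle_gge_down i h | tangle_egg_up i h | tangle_egg_down i h | untwist_ege_up i h
    | untwist_ege_down i h =>
      have hp := H.adjacent i h.1 h.2
      have h1 := H.single i h.1 (by lia)
      have h2 := H.single (i + 1) (by lia) (by lia)
      simp only [map_mul, map_smul, hG i (by lia), hG (i + 1) (by lia), hE i (by lia),
        hE (i + 1) (by lia)]
      first
      | exact hp.braid
      | exact hp.eee_up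
      | exact hp.eee_down
      | exact hp.gge_up
      | exact hp.gge_down
      | exact hp.egg_up
      | exact hp.egg_down
      | exact hp.ege_up h1 hlam
      | exact hp.symm.ege_up h2 hlam
  refine ⟨RingQuot.liftAlgHom R ⟨φ₀, hrel⟩, fun i h1 h2 => ⟨?_, ?_, ?_⟩⟩
  · rw [g, RingQuot.liftAlgHom_mkAlgHom_apply, hG i ⟨h1, h2⟩]
  · rw [gi, RingQuot.liftAlgHom_mkAlgHom_apply, hGi i ⟨h1, h2⟩]
  · rw [e, RingQuot.liftAlgHom_mkAlgHom_apply, hE i ⟨h1, h2⟩]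

variable (R lam laminv del z) in
theorem isRep (n : ℕ) : IsRep lam laminv del z n (g R lam laminv del z n) (gi R lam laminv del z n)
    (e R lam laminv del z n) := by
  have key : ∀ {x y}, Rel R lam laminv del z n x y → RingQuot.mkAlgHom R
      (Rel R lam laminv del z n) x
      = RingQuot.mkAlgHom R (Rel R lam laminv del z n) y := fun h => RingQuot.mkAlgHom_rel R h
  refine ⟨fun i h1 h2 => ⟨?_, ?_, ?_, ?_, ?_, ?_⟩,
    fun i h1 h2 => ⟨?_, ?_, ?_, ?_, ?_, ?_, ?_⟩, fun i j h1 h2 h3 => ?_, fun i j h1 h2 h3 => ?_,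
    fun i j h1 h2 h3 => ?_, fun i j h1 h2 h3 => ?_⟩
  · simpa [g, gi, e] using key (.inv_right i ⟨h1, h2⟩)
  · simpa [g, gi, e] using key (.inv_left i ⟨h1, h2⟩)
  · simpa [g, gi, e] using key (.idem i ⟨h1, h2⟩)
  · simpa [g, gi, e] using key (.skein i ⟨h1, h2⟩)
  · simpa [g, gi, e] using key (.untwist_ge i ⟨h1, h2⟩)
  · simpa [g, gi, e] using key (.untwist_eg i ⟨h1, h2⟩)
  · simpa [g, gi, e] using key (.braid i ⟨h1, h2⟩)
  · simpa [g, gi, e] using key (.tangle_eee_up i ⟨h1, h2⟩)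
  · simpa [g, gi, e] using key (.tangle_eee_down i ⟨h1, h2⟩)
  · simpa [g, gi, e] using key (.tangle_gge_up i ⟨h1, h2⟩)
  · simpa [g, gi, e] using key (.tangle_gge_down i ⟨h1, h2⟩)
  · simpa [g, gi, e] using key (.tangle_egg_up i ⟨h1, h2⟩)
  · simpa [g, gi, e] using key (.tangle_egg_down i ⟨h1, h2⟩)
  · simpa [g, gi, e] using key (.comm_gg i j (by lia))
  · simpa [g, gi, e] using key (.comm_ge i j (by lia))
  · simpa [g, gi, e] using (key (.comm_ge j i (by lia))).symm
  · simpa [g, gi, e] using key (.comm_ee i j (by lia))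

theorem algHom_ext {n : ℕ} {φ ψ : Alg R lam laminv del z n →ₐ[R] S}
    (h : ∀ i, 1 ≤ i → i < n → φ (g R lam laminv del z n i) = ψ (g R lam laminv del z n i) ∧
      φ (gi R lam laminv del z n i) = ψ (gi R lam laminv del z n i) ∧
      φ (e R lam laminv del z n i) = ψ (e R lam laminv del z n i)) : φ = ψ := by
  apply RingQuot.ringQuot_ext'
  apply FreeAlgebra.hom_ext
  funext x
  cases x with
  | g i hi => have := (h i hi.1 hi.2).1; rwa [g, FG_of hi] at this
  | gi i hi => have := (h i hi.1 hi.2).2.1; rwa [gi, FGi_of hi] at this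
  | e i hi => have := (h i hi.1 hi.2).2.2; rwa [e, FE_of hi] at this

/-- Induction on words: a submodule containing `1` and closed under left multiplication by the
generators `g i` and `e i` is everything. -/
theorem eq_top_of_mul_mem {n : ℕ} (p : Submodule R (Alg R lam laminv del z n)) (h1 : 1 ∈ p)
    (hg : ∀ i, 1 ≤ i → i < n → ∀ x ∈ p, g R lam laminv del z n i * x ∈ p)
    (he : ∀ i, 1 ≤ i → i < n → ∀ x ∈ p, e R lam laminv del z n i * x ∈ p) : p = ⊤ := by
  have hgi : ∀ i, 1 ≤ i → i < n → ∀ x ∈ p, gi R lam laminv del z n i * x ∈ p := by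
    intro i hi hi' x hx
    have hs := ((isRep R lam laminv del z n).single i hi hi').skein
    rw [sub_eq_iff_eq_add, ← sub_eq_iff_eq_add'] at hs
    rw [← hs, sub_mul, smul_mul_assoc, sub_mul, one_mul]
    exact p.sub_mem (hg i hi hi' x hx) (p.smul_mem _ (p.sub_mem (he i hi hi' x hx) hx))
  have hfree : ∀ a : FreeAlgebra R (Gen n), ∀ x ∈ p,
      RingQuot.mkAlgHom R (Rel R lam laminv del z n) a * x ∈ p := by
    intro a
    induction a with
    | grade0 r =>
      intro x hx
      rw [AlgHom.commutes, ← Algebra.smul_def]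
      exact p.smul_mem _ hx
    | grade1 y =>
      cases y with
      | g i hi => have := hg i hi.1 hi.2; rwa [g, FG_of hi] at this
      | gi i hi => have := hgi i hi.1 hi.2; rwa [gi, FGi_of hi] at this
      | e i hi => have := he i hi.1 hi.2; rwa [e, FE_of hi] at this
    | mul a b ha hb =>
      intro x hx
      rw [map_mul, mul_assoc]
      exact ha _ (hb _ hx)
    | add a b ha hb =>
      intro x hx
      rw [map_add, add_mul]
      exact p.add_mem (ha _ hx) (hb _ hx)
  refine eq_top_iff.2 fun y _ => ?_
  obtain ⟨a, rfl⟩ := RingQuot.mkAlgHom_surjective R (Rel R lam laminv del z n) y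
  simpa using hfree a 1 h1

theorem exists_extension {n : ℕ} (φ : Alg R lam laminv del z n →ₐ[R] S) (hlam : lam * laminv = 1)
    {G Gi E : S} (hs : 1 ≤ n → Single lam laminv del z G Gi E)
    (ha : 2 ≤ n → Adjacent (φ (g R lam laminv del z n (n - 1))) (φ (e R lam laminv del z n (n - 1)))
      G E)
    (hcomm : ∀ i, 1 ≤ i → i + 2 ≤ n →
      (φ (g R lam laminv del z n i) * G = G * φ (g R lam laminv del z n i) ∧
      φ (g R lam laminv del z n i) * E = E * φ (g R lam laminv del z n i)) ∧
      φ (e R lam laminv del z n i) * G = G * φ (e R lam laminv del z n i) ∧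
      φ (e R lam laminv del z n i) * E = E * φ (e R lam laminv del z n i)) :
    ∃ ψ : Alg R lam laminv del z (n + 1) →ₐ[R] S,
      (∀ i, 1 ≤ i → i < n →
        ψ (g R lam laminv del z (n + 1) i) = φ (g R lam laminv del z n i) ∧
        ψ (gi R lam laminv del z (n + 1) i) = φ (gi R lam laminv del z n i) ∧
        ψ (e R lam laminv del z (n + 1) i) = φ (e R lam laminv del z n i)) ∧
      (1 ≤ n → ψ (g R lam laminv del z (n + 1) n) = G ∧ ψ (gi R lam laminv del z (n + 1) n) = Gi ∧
        ψ (e R lam laminv del z (n + 1) n) = E) := by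
  have H := isRep R lam laminv del z n
  let G' : ℕ → S := fun i => if i < n then φ (g R lam laminv del z n i) else G
  let Gi' : ℕ → S := fun i => if i < n then φ (gi R lam laminv del z n i) else Gi
  let E' : ℕ → S := fun i => if i < n then φ (e R lam laminv del z n i) else E
  have hlt : ∀ i, i < n → G' i = φ (g R lam laminv del z n i) ∧
      Gi' i = φ (gi R lam laminv del z n i) ∧ E' i = φ (e R lam laminv del z n i) :=
    fun i hi => ⟨if_pos hi, if_pos hi, if_pos hi⟩
  have heq : G' n = G ∧ Gi' n = Gi ∧ E' n = E :=
    ⟨if_neg (lt_irrefl n), if_neg (lt_irrefl n), if_neg (lt_irrefl n)⟩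
  have H' : IsRep lam laminv del z (n + 1) G' Gi' E' := by
    constructor
    · intro i h1 h2
      rcases Nat.lt_or_eq_of_le (Nat.le_of_lt_succ h2) with h | rfl
      · have := H.single i h1 h
        obtain ⟨e1, e2, e3⟩ := hlt i h
        rw [e1, e2, e3]
        constructor
        · rw [← map_mul, this.g_gi, map_one]
        · rw [← map_mul, this.gi_g, map_one]
        · rw [← map_mul, this.e_e, map_smul]
        · rw [← map_sub, this.skein, map_smul, map_sub, map_one]
        · rw [← map_mul, this.g_e, map_smul]
        · rw [← map_mul, this.e_g, map_smul]
      · rw [heq.1, heq.2.1, heq.2.2]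
        exact hs h1
    · intro i h1 h2
      rcases Nat.lt_or_eq_of_le (Nat.le_of_lt_succ h2) with h | rfl
      · have := H.adjacent i h1 h
        obtain ⟨e1, -, e3⟩ := hlt i (by lia)
        obtain ⟨e1', -, e3'⟩ := hlt (i + 1) h
        rw [e1, e3, e1', e3']
        constructor <;> simp only [← map_mul]
        · rw [this.braid]
        · rw [this.eee_up]
        · rw [this.eee_down]
        · rw [this.gge_up]
        · rw [this.gge_down]
        · rw [this.egg_up]
        · rw [this.egg_down]
      · obtain ⟨e1, -, e3⟩ := hlt i (by lia)
        rw [e1, e3, heq.1, heq.2.2]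
        exact ha (by lia)
    all_goals
      intro i j h1 h2 h3
      obtain ⟨e1, -, e3⟩ := hlt i (by lia)
      rcases Nat.lt_or_eq_of_le (Nat.le_of_lt_succ h3) with h | rfl
      · obtain ⟨e1', -, e3'⟩ := hlt j h
        simp only [e1, e3, e1', e3', ← map_mul]
        first
        | rw [H.comm_gg i j h1 h2 h]
        | rw [H.comm_ge i j h1 h2 h]
        | rw [H.comm_eg i j h1 h2 h]
        | rw [H.comm_ee i j h1 h2 h]
      · simp only [e1, e3, heq.1, heq.2.2]
        obtain ⟨⟨c1, c2⟩, c3, c4⟩ := hcomm i h1 h2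
        first
        | exact c1
        | exact c2
        | exact c3
        | exact c4
  obtain ⟨ψ, hψ⟩ := H'.exists_algHom hlam
  refine ⟨ψ, fun i h1 h2 => ?_, fun h1 => ?_⟩
  · rw [(hψ i h1 (by lia)).1, (hψ i h1 (by lia)).2.1, (hψ i h1 (by lia)).2.2]
    exact hlt i h2
  · rw [(hψ n h1 (by lia)).1, (hψ n h1 (by lia)).2.1, (hψ n h1 (by lia)).2.2]
    exact heq

theorem exists_inclusion (hlam : lam * laminv = 1) (m : ℕ) :
    ∃ ι : Alg R lam laminv del z m →ₐ[R] Alg R lam laminv del z (m + 1),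
      ∀ i, 1 ≤ i → i < m →
        ι (g R lam laminv del z m i) = g R lam laminv del z (m + 1) i ∧
        ι (gi R lam laminv del z m i) = gi R lam laminv del z (m + 1) i ∧
        ι (e R lam laminv del z m i) = e R lam laminv del z (m + 1) i := by
  have H := isRep R lam laminv del z (m + 1)
  refine IsRep.exists_algHom ⟨fun i h1 h2 => H.single i h1 (by lia),
    fun i h1 h2 => H.adjacent i h1 (by lia), fun i j h1 h2 h3 => H.comm_gg i j h1 h2 (by lia),
    fun i j h1 h2 h3 => H.comm_ge i j h1 h2 (by lia),
    fun i j h1 h2 h3 => H.comm_eg i j h1 h2 (by lia),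
    fun i j h1 h2 h3 => H.comm_ee i j h1 h2 (by lia)⟩ hlam

end Representations

section Pairs

variable {R : Type*} [CommRing R] {lam laminv del z : R} {S : Type*} [Ring S] [Algebra R S]

/-- Two adjacent triples of generators, together with the invertibility of `lam`. -/
structure Pair (lam laminv del z : R) (h hi f g gi e : S) : Prop where
  hlam : lam * laminv = 1
  fst : Single lam laminv del z h hi f
  snd : Single lam laminv del z g gi e
  adj : Adjacent h f g e

namespace Single

variable {g gi e : S} (s : Single lam laminv del z g gi e)
include s

theorem gi_eq : gi = g - z • e + z • 1 := by
  linear_combination (norm := module) -s.skein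

theorem g_g : g * g = 1 + (z * laminv) • e - z • g := by
  have := congrArg (g * ·) s.gi_eq
  simp only [mul_add, mul_sub, mul_smul_comm, s.g_gi, s.g_e, mul_one, smul_smul] at this
  linear_combination (norm := module) -this

theorem gi_gi (hlam : lam * laminv = 1) : gi * gi = 1 - (z * lam) • e + z • gi := by
  have := congrArg (gi * ·) s.gi_eq
  simp only [mul_add, mul_sub, mul_smul_comm, s.gi_g, s.gi_e hlam, mul_one, smul_smul] at this
  linear_combination (norm := module) this

theorem gi_mul_g_mul (x : S) : gi * (g * x) = x := by rw [← mul_assoc, s.gi_g, one_mul]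
theorem g_mul_gi_mul (x : S) : g * (gi * x) = x := by rw [← mul_assoc, s.g_gi, one_mul]
theorem mul_g_mul_gi (x : S) : x * g * gi = x := by rw [mul_assoc, s.g_gi, mul_one]

end Single

namespace Pair

variable {h hi f g gi e : S} (P : Pair lam laminv del z h hi f g gi e)
include P

theorem symm : Pair lam laminv del z g gi e h hi f := ⟨P.hlam, P.snd, P.fst, P.adj.symm⟩

theorem gf : g * f = hi * e * f := by
  rw [mul_assoc, ← P.adj.gge_up, mul_assoc, P.fst.gi_mul_g_mul]

theorem fg : f * g = f * e * hi := by
  rw [← P.adj.egg_up, P.fst.mul_g_mul_gi]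

theorem gfe : g * f * e = hi * e := by rw [P.gf, mul_assoc, mul_assoc, ← mul_assoc e,
    P.adj.eee_down]
theorem efg : e * f * g = e * hi := by
  rw [mul_assoc, P.fg, ← mul_assoc, ← mul_assoc, P.adj.eee_down]

theorem gif : gi * f = h * e * f := by
  have := P.symm.gfe
  rw [this]

theorem fgi : f * gi = f * e * h := P.symm.efg.symm

theorem gfg : g * f * g = hi * e * hi := by
  rw [P.gf, mul_assoc, P.fg, ← mul_assoc, ← mul_assoc, mul_assoc hi e f,
    mul_assoc hi, P.adj.eee_down]

theorem gife : gi * f * e = h * e := by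
  rw [P.gif, mul_assoc, mul_assoc, ← mul_assoc e, P.adj.eee_down]

theorem efgi : e * f * gi = e * h := by
  rw [mul_assoc, P.fgi, ← mul_assoc, ← mul_assoc, P.adj.eee_down]

theorem ghe : g * h * e = f * e := P.adj.gge_down
theorem ehg : e * h * g = e * f := P.adj.egg_down
theorem hgf : h * g * f = e * f := P.adj.gge_up
theorem fgh : f * g * h = f * e := P.adj.egg_up

theorem gihie : gi * hi * e = f * e := by
  rw [mul_assoc, P.symm.gif, mul_assoc, P.snd.gi_mul_g_mul]

theorem higif : hi * gi * f = e * f := P.symm.gihie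

theorem ehigi : e * hi * gi = e * f := by
  rw [P.symm.fgi, P.snd.mul_g_mul_gi]

theorem fgihi : f * gi * hi = f * e := P.symm.ehigi

theorem ehe : e * h * e = lam • e := P.adj.symm.ege_up P.snd P.hlam

theorem ehie : e * hi * e = laminv • e := by
  rw [← P.efg, mul_assoc, P.snd.g_e, mul_smul_comm, P.adj.eee_down]

theorem efe : e * f * e = e := P.adj.eee_down

theorem fef : f * e * f = f := P.adj.eee_up

theorem braid : g * h * g = h * g * h := P.adj.braid.symm

theorem ghigi : g * hi * gi = hi * gi * h :=
  calc g * hi * gi = hi * gi * (g * h * g) * hi * gi := by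
        simp only [mul_assoc, P.snd.gi_mul_g_mul, P.fst.gi_mul_g_mul]
    _ = hi * gi * h := by
        rw [P.braid]
        simp only [mul_assoc, P.fst.g_mul_gi_mul, P.snd.g_gi, mul_one]

end Pair

end Pairs

section Generation

variable {R : Type*} [CommRing R] {lam laminv del z : R}

/-- The canonical homomorphism `W_{m,R} → W_{m+1,R}`. -/
noncomputable def incl (hlam : lam * laminv = 1) (m : ℕ) :
    Alg R lam laminv del z m →ₐ[R] Alg R lam laminv del z (m + 1) :=
  (exists_inclusion hlam m).choose

theorem incl_spec (hlam : lam * laminv = 1) (m i : ℕ) (h1 : 1 ≤ i) (h2 : i < m) :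
    incl hlam m (g R lam laminv del z m i) = g R lam laminv del z (m + 1) i ∧
    incl hlam m (gi R lam laminv del z m i) = gi R lam laminv del z (m + 1) i ∧
    incl hlam m (e R lam laminv del z m i) = e R lam laminv del z (m + 1) i :=
  (exists_inclusion hlam m).choose_spec i h1 h2

theorem single (m : ℕ) : Single lam laminv del z (g R lam laminv del z (m + 2) (m + 1))
    (gi R lam laminv del z (m + 2) (m + 1)) (e R lam laminv del z (m + 2) (m + 1)) :=
  (isRep R lam laminv del z (m + 2)).single (m + 1) (by lia) (by lia)

theorem pair (hlam : lam * laminv = 1) (m : ℕ) (hm : 1 ≤ m) : Pair lam laminv del z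
    (incl hlam (m + 1) (g R lam laminv del z (m + 1) m))
    (incl hlam (m + 1) (gi R lam laminv del z (m + 1) m))
    (incl hlam (m + 1) (e R lam laminv del z (m + 1) m))
    (g R lam laminv del z (m + 2) (m + 1))
    (gi R lam laminv del z (m + 2) (m + 1)) (e R lam laminv del z (m + 2) (m + 1)) := by
  obtain ⟨h1, h2, h3⟩ := incl_spec (R := R) (del := del) (z := z) hlam (m + 1) m hm (by lia)
  rw [h1, h2, h3]
  exact ⟨hlam, (isRep R lam laminv del z (m + 2)).single m hm (by lia), single m,
    (isRep R lam laminv del z (m + 2)).adjacent m hm (by lia)⟩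

/-- The last generators of `W_{m+2}` commute with `W_m`. -/
theorem comm_incl (hlam : lam * laminv = 1) (m : ℕ) (c : Alg R lam laminv del z m) :
    g R lam laminv del z (m + 2) (m + 1) * incl hlam (m + 1) (incl hlam m c) =
      incl hlam (m + 1) (incl hlam m c) * g R lam laminv del z (m + 2) (m + 1) ∧
    e R lam laminv del z (m + 2) (m + 1) * incl hlam (m + 1) (incl hlam m c) =
      incl hlam (m + 1) (incl hlam m c) * e R lam laminv del z (m + 2) (m + 1) := by
  have H := isRep R lam laminv del z (m + 2)
  have gen : ∀ i, 1 ≤ i → i < m →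
      incl hlam (m + 1) (incl hlam m (g R lam laminv del z m i)) = g R lam laminv del z (m + 2) i ∧
      incl hlam (m + 1) (incl hlam m (e R lam laminv del z m i)) =
        e R lam laminv del z (m + 2) i := by
    intro i h1 h2
    rw [(incl_spec hlam m i h1 h2).1, (incl_spec hlam m i h1 h2).2.2,
      (incl_spec hlam (m + 1) i h1 (by lia)).1, (incl_spec hlam (m + 1) i h1 (by lia)).2.2]
    exact ⟨rfl, rfl⟩
  have key : ∀ y : Alg R lam laminv del z (m + 2),
      (∀ i, 1 ≤ i → i < m → y * g R lam laminv del z (m + 2) i = g R lam laminv del z (m + 2) i *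
        y ∧
        y * e R lam laminv del z (m + 2) i = e R lam laminv del z (m + 2) i * y) →
      ∀ c, y * incl hlam (m + 1) (incl hlam m c) = incl hlam (m + 1) (incl hlam m c) * y := by
    intro y hy c
    let p : Submodule R (Alg R lam laminv del z m) :=
      { carrier := {c | y * incl hlam (m + 1) (incl hlam m c) =
          incl hlam (m + 1) (incl hlam m c) * y}
        add_mem' := fun {a b} ha hb => by
          simp only [Set.mem_ofPred_eq] at ha hb
          simp only [Set.mem_ofPred_eq, map_add, mul_add, add_mul, ha, hb]
        zero_mem' := by simp
        smul_mem' := fun r a ha => by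
          simp only [Set.mem_ofPred_eq] at ha
          simp only [Set.mem_ofPred_eq, map_smul, mul_smul_comm, smul_mul_assoc, ha] }
    have hp : p = ⊤ := by
      apply eq_top_of_mul_mem p
      · change y * _ = _ * y
        simp
      · intro i h1 h2 x hx
        have hx' : y * incl hlam (m + 1) (incl hlam m x) =
          incl hlam (m + 1) (incl hlam m x) * y := hx
        change y * _ = _ * y
        rw [map_mul, map_mul, (gen i h1 h2).1, ← mul_assoc, (hy i h1 h2).1, mul_assoc, hx',
          mul_assoc]
      · intro i h1 h2 x hx
        have hx' : y * incl hlam (m + 1) (incl hlam m x) =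
          incl hlam (m + 1) (incl hlam m x) * y := hx
        change y * _ = _ * y
        rw [map_mul, map_mul, (gen i h1 h2).2, ← mul_assoc, (hy i h1 h2).2, mul_assoc, hx',
          mul_assoc]
    have : c ∈ p := hp ▸ Submodule.mem_top
    exact this
  refine ⟨key _ (fun i h1 h2 => ⟨?_, ?_⟩) c, key _ (fun i h1 h2 => ⟨?_, ?_⟩) c⟩
  · exact (H.comm_gg i (m + 1) h1 (by lia) (by lia)).symm
  · exact (H.comm_eg i (m + 1) h1 (by lia) (by lia)).symm
  · exact (H.comm_ge i (m + 1) h1 (by lia) (by lia)).symm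
  · exact (H.comm_ee i (m + 1) h1 (by lia) (by lia)).symm

/-- `W_{m+1}` is generated by `1`, `g m` and `e m` as a bimodule over `W_m`. -/
theorem bimod_gen (hlam : lam * laminv = 1) (m : ℕ) (p : Submodule R (Alg R lam laminv del z
    (m + 1)))
    (hl : ∀ a x, x ∈ p → incl hlam m a * x ∈ p) (hr : ∀ x a, x ∈ p → x * incl hlam m a ∈ p)
    (h1 : 1 ∈ p) (hg : 1 ≤ m → g R lam laminv del z (m + 1) m ∈ p)
    (he : 1 ≤ m → e R lam laminv del z (m + 1) m ∈ p) : p = ⊤ := by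
  induction m with
  | zero => exact eq_top_of_mul_mem p h1 (fun i h1 h2 => by lia) (fun i h1 h2 => by lia)
  | succ m ih =>
    set ι := incl (R := R) (del := del) (z := z) hlam (m + 1) with hι
    set G := g R lam laminv del z (m + 2) (m + 1) with hG
    set E := e R lam laminv del z (m + 2) (m + 1) with hE
    let T : Set (Alg R lam laminv del z (m + 2)) := {1, G, E}
    let q : Submodule R (Alg R lam laminv del z (m + 2)) :=
      Submodule.span R {x | ∃ a, ∃ s ∈ T, ∃ b, x = ι a * s * ι b}
    have hqp : q ≤ p := by
      refine Submodule.span_le.2 ?_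
      rintro _ ⟨a, s, hs, b, rfl⟩
      refine hr _ _ (hl _ _ ?_)
      rcases hs with rfl | rfl | rfl
      exacts [h1, hg (by lia), he (by lia)]
    have ql : ∀ a x, x ∈ q → ι a * x ∈ q := by
      intro a x hx
      induction hx using Submodule.span_induction with
      | mem x hx =>
        obtain ⟨a', s, hs, b, rfl⟩ := hx
        exact Submodule.subset_span ⟨a * a', s, hs, b, by simp only [map_mul, mul_assoc]⟩
      | zero => simp
      | add x y _ _ hx hy => rw [mul_add]; exact q.add_mem hx hy
      | smul r x _ hx => rw [mul_smul_comm]; exact q.smul_mem _ hx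
    have qr : ∀ a x, x ∈ q → x * ι a ∈ q := by
      intro a x hx
      induction hx using Submodule.span_induction with
      | mem x hx =>
        obtain ⟨a', s, hs, b, rfl⟩ := hx
        exact Submodule.subset_span ⟨a', s, hs, b * a, by simp only [map_mul, mul_assoc]⟩
      | zero => simp
      | add x y _ _ hx hy => rw [add_mul]; exact q.add_mem hx hy
      | smul r x _ hx => rw [smul_mul_assoc]; exact q.smul_mem _ hx
    have qT : ∀ s ∈ T, s ∈ q := fun s hs => Submodule.subset_span ⟨1, s, hs, 1, by simp⟩
    have q1 : (1 : Alg R lam laminv del z (m + 2)) ∈ q := qT 1 (by simp [T])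
    have qg : G ∈ q := qT G (by simp [T])
    have qe : E ∈ q := qT E (by simp [T])
    have gT : G ∈ T := by simp [T]
    have eT : E ∈ T := by simp [T]
    have hs := single (R := R) (lam := lam) (laminv := laminv) (del := del) (z := z) m
    rw [← hG, ← hE] at hs
    have hT : ∀ s ∈ T, ∀ c, s * ι (incl hlam m c) = ι (incl hlam m c) * s := by
      rintro s (rfl | rfl | rfl) c
      · simp
      · exact (comm_incl hlam m c).1
      · exact (comm_incl hlam m c).2
    have key : ∀ t ∈ T, ∀ a, ∀ s ∈ T, t * ι a * s ∈ q := by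
      intro t ht
      let r : Submodule R (Alg R lam laminv del z (m + 1)) :=
        { carrier := {a | ∀ s ∈ T, t * ι a * s ∈ q}
          add_mem' := fun {a b} ha hb s hs => by
            rw [map_add, mul_add, add_mul]
            exact q.add_mem (ha s hs) (hb s hs)
          zero_mem' := fun s _ => by simp
          smul_mem' := fun k a ha s hs => by
            rw [map_smul, mul_smul_comm, smul_mul_assoc]
            exact q.smul_mem _ (ha s hs) }
      have hgg : G * G ∈ q := by
        rw [hs.g_g]
        exact q.sub_mem (q.add_mem q1 (q.smul_mem _ qe)) (q.smul_mem _ qg)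
      have hge : G * E ∈ q := by rw [hs.g_e]; exact q.smul_mem _ qe
      have heg : E * G ∈ q := by rw [hs.e_g]; exact q.smul_mem _ qe
      have hee : E * E ∈ q := by rw [hs.e_e]; exact q.smul_mem _ qe
      have hr : r = ⊤ := by
        apply ih r
        · intro c x hx s hs
          rw [map_mul, ← mul_assoc, hT t ht, mul_assoc, mul_assoc, ← mul_assoc t]
          exact ql _ _ (hx s hs)
        · intro x c hx s hs
          rw [map_mul, mul_assoc, mul_assoc, ← hT s hs, ← mul_assoc, ← mul_assoc]
          exact qr _ _ (hx s hs)
        · intro s hs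
          rw [map_one, mul_one]
          rcases ht with rfl | rfl | rfl <;> rcases hs with rfl | rfl | rfl <;>
            (try simp only [mul_one, one_mul]) <;> assumption
        · intro hm s hs
          have P := pair (R := R) (del := del) (z := z) hlam m hm
          rw [← hι, ← hG, ← hE] at P
          rcases ht with rfl | rfl | rfl <;> rcases hs with rfl | rfl | rfl <;>
            (try simp only [mul_one, one_mul])
          · simpa using ql _ _ q1
          · exact ql _ _ qg
          · exact ql _ _ qe
          · exact qr _ _ qg
          · rw [P.braid]; exact qr _ _ (ql _ _ qg)
          · rw [P.ghe]; exact ql _ _ qe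
          · exact qr _ _ qe
          · rw [P.ehg]; exact qr _ _ qe
          · rw [P.ehe]; exact q.smul_mem _ qe
        · intro hm s hs
          have P := pair (R := R) (del := del) (z := z) hlam m hm
          rw [← hι, ← hG, ← hE] at P
          rcases ht with rfl | rfl | rfl <;> rcases hs with rfl | rfl | rfl <;>
            (try simp only [mul_one, one_mul])
          · simpa using ql _ _ q1
          · exact ql _ _ qg
          · exact ql _ _ qe
          · exact qr _ _ qg
          · rw [P.gfg]; exact qr _ _ (ql _ _ qe)
          · rw [P.gfe]; exact ql _ _ qe
          · exact qr _ _ qe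
          · rw [P.efg]; exact qr _ _ qe
          · rw [P.efe]; exact qe
      intro a s hs
      have : a ∈ r := hr ▸ Submodule.mem_top
      exact this s hs
    have key' : ∀ t ∈ T, ∀ x ∈ q, t * x ∈ q := by
      intro t ht x hx
      induction hx using Submodule.span_induction with
      | mem x hx =>
        obtain ⟨a', s, hs, b, rfl⟩ := hx
        rw [← mul_assoc, ← mul_assoc]
        exact qr _ _ (key t ht a' s hs)
      | zero => simp
      | add x y _ _ hx hy => rw [mul_add]; exact q.add_mem hx hy
      | smul r x _ hx => rw [mul_smul_comm]; exact q.smul_mem _ hx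
    refine eq_top_iff.2 (le_trans (eq_top_iff.1 (eq_top_of_mul_mem q q1 ?_ ?_)) hqp)
    · intro i i1 i2 x hx
      rcases Nat.lt_or_eq_of_le (Nat.le_of_lt_succ i2) with h | rfl
      · rw [← (incl_spec hlam (m + 1) i i1 h).1]
        exact ql _ _ hx
      · exact key' _ gT x hx
    · intro i i1 i2 x hx
      rcases Nat.lt_or_eq_of_le (Nat.le_of_lt_succ i2) with h | rfl
      · rw [← (incl_spec hlam (m + 1) i i1 h).2.2]
        exact ql _ _ hx
      · exact key' _ eT x hx

end Generation

section Tower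

variable {R C B A : Type u} [CommRing R] [Ring C] [Algebra R C] [Ring B] [Algebra R B] [Ring A]
  [Algebra R A]

/-- `A` is the universal `B`-bimodule on a central generator `1` and two generators `g`, `e`
commuting with `C`, subject to the relations `g f = hi e f`, `f g = f e hi`, `f e f = f`
(imposed only if `c` holds). -/
def IsUniversal (c : Prop) (ιC : C →ₐ[R] B) (ιB : B →ₐ[R] A) (hi f : B) (g e : A) : Prop :=
  ∀ (X : Type u) [AddCommGroup X] [Module R X] (L : B →ₐ[R] Module.End R X)
    (Q : Bᵐᵒᵖ →ₐ[R] Module.End R X) (x y w : X),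
    (∀ a b v, L a (Q b v) = Q b (L a v)) →
    (∀ b, L b x = Q (.op b) x) → (∀ c, L (ιC c) y = Q (.op (ιC c)) y) →
    (∀ c, L (ιC c) w = Q (.op (ιC c)) w) →
    (c → Q (.op f) y = L hi (Q (.op f) w)) → (c → L f y = L f (Q (.op hi) w)) →
    (c → L f (Q (.op f) w) = L f x) →
    ∃ F : A →ₗ[R] X, F 1 = x ∧ F g = y ∧ F e = w ∧ (∀ b v, F (ιB b * v) = L b (F v)) ∧
      ∀ v b, F (v * ιB b) = Q (.op b) (F v)

/-- Three consecutive algebras `C → B → A` behaving like `W_m → W_{m+1} → W_{m+2}`, the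
universal property being assumed for `A` over `B`. -/
structure Tower (lam laminv del z : R) (c : Prop) (ιC : C →ₐ[R] B) (ιB : B →ₐ[R] A) (h hi f : B)
    (g gi e : A) : Prop where
  hlam : lam * laminv = 1
  hskein : laminv - lam = z * (del - 1)
  singleA : Single lam laminv del z g gi e
  singleB : c → Single lam laminv del z h hi f
  pair : c → Pair lam laminv del z (ιB h) (ιB hi) (ιB f) g gi e
  comm_g : ∀ x, g * ιB (ιC x) = ιB (ιC x) * g
  comm_e : ∀ x, e * ιB (ιC x) = ιB (ιC x) * e
  genA : ∀ p : Submodule R A, (∀ a x, x ∈ p → ιB a * x ∈ p) → (∀ x a, x ∈ p → x * ιB a ∈ p) →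
    1 ∈ p → g ∈ p → e ∈ p → p = ⊤
  genB : ∀ p : Submodule R B, (∀ a x, x ∈ p → ιC a * x ∈ p) → (∀ x a, x ∈ p → x * ιC a ∈ p) →
    1 ∈ p → (c → h ∈ p) → (c → f ∈ p) → p = ⊤
  univ : IsUniversal c ιC ιB hi f g e

/-- A predicate closed under linear combinations, as a submodule. -/
def predSubmodule {M : Type*} [AddCommGroup M] [Module R M] (p : M → Prop) (h0 : p 0)
    (hadd : ∀ x y, p x → p y → p (x + y)) (hsmul : ∀ (r : R) x, p x → p (r • x)) :
    Submodule R M where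
  carrier := {x | p x}
  add_mem' := fun {a b} ha hb => hadd a b ha hb
  zero_mem' := h0
  smul_mem' := fun r a ha => hsmul r a ha

theorem pred_of_eq_top {M : Type*} [AddCommGroup M] [Module R M] {p : M → Prop} {h0 : p 0}
    {hadd : ∀ x y, p x → p y → p (x + y)} {hsmul : ∀ (r : R) x, p x → p (r • x)}
    (h : predSubmodule p h0 hadd hsmul = ⊤) (x : M) : p x := by
  have : x ∈ predSubmodule p h0 hadd hsmul := h ▸ Submodule.mem_top
  exact this

namespace Tower

variable {lam laminv del z : R} {c : Prop} {ιC : C →ₐ[R] B} {ιB : B →ₐ[R] A} {h hi f : B}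
    {g gi e : A} (t : Tower lam laminv del z c ιC ιB h hi f g gi e)
include t

theorem gi_comm (x : C) : gi * ιB (ιC x) = ιB (ιC x) * gi :=
  t.singleA.commute (t.comm_g x)

/-- Induction principle for `A` as a `B`-bimodule. -/
theorem induct {p : A → Prop} (h0 : p 0)
    (hadd : ∀ x y, p x → p y → p (x + y)) (hsmul : ∀ (r : R) x, p x → p (r • x))
    (hl : ∀ b x, p x → p (ιB b * x)) (hr : ∀ x b, p x → p (x * ιB b))
    (h1 : p 1) (hg : p g) (he : p e) (x : A) : p x :=
  pred_of_eq_top (h0 := h0) (hadd := hadd) (hsmul := hsmul) (t.genA _ hl hr h1 hg he) x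

/-- Induction principle for `A` as a `B`-`C`-bimodule. -/
theorem induct_right {p : A → Prop} (h0 : p 0)
    (hadd : ∀ x y, p x → p y → p (x + y)) (hsmul : ∀ (r : R) x, p x → p (r • x))
    (hl : ∀ b x, p x → p (ιB b * x)) (hr : ∀ x a, p x → p (x * ιB (ιC a)))
    (h1 : p 1) (hg : p g) (he : p e) (hgh : c → p (g * ιB h)) (heh : c → p (e * ιB h))
    (hef : c → p (e * ιB f)) (x : A) : p x := by
  have key : ∀ s : A, p s → (∀ a, s * ιB (ιC a) = ιB (ιC a) * s) → (c → p (s * ιB h)) →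
      (c → p (s * ιB f)) → ∀ b, p (s * ιB b) := by
    intro s h1 hs hh hf
    refine pred_of_eq_top (h0 := by simpa using h0)
      (hadd := fun x y hx hy => by simpa [mul_add] using hadd _ _ hx hy)
      (hsmul := fun r x hx => by simpa using hsmul r _ hx) (t.genB _ ?_ ?_ ?_ hh hf)
    · intro a x hx
      change p _
      rw [map_mul, ← mul_assoc, hs, mul_assoc]
      exact hl _ _ hx
    · intro x a hx
      change p _
      rw [map_mul, ← mul_assoc]
      exact hr _ _ hx
    · change p _
      simpa using h1
  refine t.induct (p := fun x => ∀ b, p (x * ιB b)) ?_ ?_ ?_ ?_ ?_ ?_ ?_ ?_ x 1 |>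
    fun hx => by simpa using hx
  · simpa using h0
  · intro x y hx hy b
    rw [add_mul]
    exact hadd _ _ (hx b) (hy b)
  · intro r x hx b
    rw [smul_mul_assoc]
    exact hsmul _ _ (hx b)
  · intro b x hx b'
    rw [mul_assoc]
    exact hl _ _ (hx b')
  · intro x b hx b'
    rw [mul_assoc, ← map_mul]
    exact hx _
  · intro b
    simpa using hl b 1 h1
  · refine key g hg t.comm_g hgh fun hc => ?_
    rw [(t.pair hc).gf, mul_assoc]
    exact hl _ _ (hef hc)
  · exact key e he t.comm_e heh hef

/-- Induction principle for `A` as a `C`-`B`-bimodule. -/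
theorem induct_left {p : A → Prop} (h0 : p 0)
    (hadd : ∀ x y, p x → p y → p (x + y)) (hsmul : ∀ (r : R) x, p x → p (r • x))
    (hl : ∀ a x, p x → p (ιB (ιC a) * x)) (hr : ∀ x b, p x → p (x * ιB b))
    (h1 : p 1) (hg : p g) (he : p e) (hhg : c → p (ιB h * g)) (hhe : c → p (ιB h * e))
    (hfe : c → p (ιB f * e)) (x : A) : p x := by
  have key : ∀ s : A, p s → (∀ a, s * ιB (ιC a) = ιB (ιC a) * s) → (c → p (ιB h * s)) →
      (c → p (ιB f * s)) → ∀ b, p (ιB b * s) := by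
    intro s h1 hs hh hf
    refine pred_of_eq_top (h0 := by simpa using h0)
      (hadd := fun x y hx hy => by simpa [add_mul] using hadd _ _ hx hy)
      (hsmul := fun r x hx => by simpa using hsmul r _ hx) (t.genB _ ?_ ?_ ?_ hh hf)
    · intro a x hx
      change p _
      rw [map_mul, mul_assoc]
      exact hl _ _ hx
    · intro x a hx
      change p _
      rw [map_mul, mul_assoc, ← hs, ← mul_assoc]
      exact hr _ _ hx
    · change p _
      simpa using h1
  refine t.induct (p := fun x => ∀ b, p (ιB b * x)) ?_ ?_ ?_ ?_ ?_ ?_ ?_ ?_ x 1 |>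
    fun hx => by simpa using hx
  · simpa using h0
  · intro x y hx hy b
    rw [mul_add]
    exact hadd _ _ (hx b) (hy b)
  · intro r x hx b
    rw [mul_smul_comm]
    exact hsmul _ _ (hx b)
  · intro b x hx b'
    rw [← mul_assoc, ← map_mul]
    exact hx _
  · intro x b hx b'
    rw [← mul_assoc]
    exact hr _ _ (hx b')
  · intro b
    simpa using hr 1 b h1
  · refine key g hg t.comm_g hhg fun hc => ?_
    rw [(t.pair hc).fg]
    exact hr _ _ (hfe hc)
  · exact key e he t.comm_e hhe hfe

theorem exists_mul_e (x : A) : ∃ b, x * e = ιB b * e := by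
  refine t.induct_right (p := fun x => ∃ b, x * e = ιB b * e) ⟨0, by simp⟩ ?_ ?_ ?_ ?_ ⟨1, by simp⟩
    ⟨laminv • 1, by simp [t.singleA.g_e]⟩ ⟨del • 1, by simp [t.singleA.e_e]⟩
    (fun hc => ⟨f, (t.pair hc).ghe⟩)
    (fun hc => ⟨lam • 1, by simp [(t.pair hc).ehe]⟩)
    (fun hc => ⟨1, by simp [(t.pair hc).efe]⟩) x
  · rintro x y ⟨b, hb⟩ ⟨b', hb'⟩
    exact ⟨b + b', by rw [add_mul, map_add, add_mul, hb, hb']⟩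
  · rintro r x ⟨b, hb⟩
    exact ⟨r • b, by rw [smul_mul_assoc, map_smul, smul_mul_assoc, hb]⟩
  · rintro b x ⟨b', hb⟩
    exact ⟨b * b', by rw [mul_assoc, map_mul, mul_assoc, hb]⟩
  · rintro x a ⟨b, hb⟩
    exact ⟨b * ιC a, by rw [mul_assoc, ← t.comm_e, ← mul_assoc, hb, map_mul, mul_assoc, t.comm_e,
      mul_assoc]⟩

theorem exists_e_mul (x : A) : ∃ b, e * x = e * ιB b := by
  refine t.induct_left (p := fun x => ∃ b, e * x = e * ιB b) ⟨0, by simp⟩ ?_ ?_ ?_ ?_ ⟨1, by simp⟩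
    ⟨laminv • 1, by simp [t.singleA.e_g]⟩ ⟨del • 1, by simp [t.singleA.e_e]⟩
    (fun hc => ⟨f, by rw [← mul_assoc, (t.pair hc).ehg]⟩)
    (fun hc => ⟨lam • 1, by simp [← mul_assoc, (t.pair hc).ehe]⟩)
    (fun hc => ⟨1, by simp [← mul_assoc, (t.pair hc).efe]⟩) x
  · rintro x y ⟨b, hb⟩ ⟨b', hb'⟩
    exact ⟨b + b', by rw [mul_add, map_add, mul_add, hb, hb']⟩
  · rintro r x ⟨b, hb⟩
    exact ⟨r • b, by rw [mul_smul_comm, map_smul, mul_smul_comm, hb]⟩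
  · rintro a x ⟨b, hb⟩
    exact ⟨ιC a * b, by rw [← mul_assoc, t.comm_e, mul_assoc, hb, map_mul, ← mul_assoc, ← t.comm_e,
      mul_assoc]⟩
  · rintro x b ⟨b', hb⟩
    exact ⟨b' * b, by rw [← mul_assoc, map_mul, ← mul_assoc, hb]⟩

/-- The universal property, for bimodules over an algebra `S` receiving a map from `B`. -/
theorem exists_bimod_map {S X : Type u} [Ring S] [Algebra R S] (j : B →ₐ[R] S) [AddCommGroup X]
    [Module R X] [Module S X] [Module Sᵐᵒᵖ X] [SMulCommClass S Sᵐᵒᵖ X] [IsScalarTower R S X]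
    [IsScalarTower R Sᵐᵒᵖ X] (x y w : X)
    (hx : ∀ b, j b • x = x <• j b) (hy : ∀ a, j (ιC a) • y = y <• j (ιC a))
    (hw : ∀ a, j (ιC a) • w = w <• j (ιC a))
    (hr : c → y <• j f = j hi • w <• j f) (hl : c → j f • y = j f • w <• j hi)
    (hb : c → j f • w <• j f = j f • x) :
    ∃ F : A →ₗ[R] X, F 1 = x ∧ F g = y ∧ F e = w ∧ (∀ b v, F (ιB b * v) = j b • F v) ∧
      ∀ v b, F (v * ιB b) = F v <• j b :=
  t.univ X ((Algebra.lsmul R R X).comp j) ((Algebra.lsmul R R X).comp j.op) x y w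
    (fun a b v => smul_comm (j a) (MulOpposite.op (j b.unop)) v) hx hy hw hr hl hb

theorem exists_closure_twist : ∃ T : A →ₗ[R] A, T 1 = laminv • 1 ∧ T g = e ∧ T e = gi ∧
    (∀ b v, T (ιB b * v) = ιB b * T v) ∧ ∀ v b, T (v * ιB b) = T v * ιB b := by
  refine t.exists_bimod_map ιB _ _ _ (fun b => ?_) (fun a => (t.comm_e a).symm)
    (fun a => (t.gi_comm a).symm) (fun hc => ?_) (fun hc => ?_) (fun hc => ?_)
  · simp
  · simp [← mul_assoc, (t.pair hc).higif]
  · simp [← mul_assoc, (t.pair hc).fgihi]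
  · simp [← mul_assoc, (t.pair hc).symm.ehie]

theorem exists_contraction : ∃ K : A →ₗ[R] B, K 1 = del • 1 ∧ K g = lam • 1 ∧ K e = 1 ∧
    (∀ b v, K (ιB b * v) = b * K v) ∧ ∀ v b, K (v * ιB b) = K v * b := by
  refine t.exists_bimod_map (AlgHom.id R B) _ _ _ (fun b => ?_) (fun a => ?_)
    (fun a => ?_) (fun hc => ?_) (fun hc => ?_) (fun hc => ?_)
  · simp
  · simp
  · simp
  · simp [(t.singleB hc).gi_e t.hlam]
  · simp [(t.singleB hc).e_gi t.hlam]
  · simp [(t.singleB hc).e_e]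

theorem exists_braiding : ∃ θ : A →ₗ[R] PresBimod ιB gi e,
    θ 1 = PresBimod.one ιB gi e + (z * laminv) • PresBimod.cup ιB gi e - z • PresBimod.gen ιB gi e ∧
    θ g = g • (PresBimod.gen ιB gi e <• g) ∧ θ e = gi • (PresBimod.cup ιB gi e <• gi) ∧
    (∀ b v, θ (ιB b * v) = ιB b • θ v) ∧ ∀ v b, θ (v * ιB b) = θ v <• ιB b := by
  refine t.exists_bimod_map ιB _ _ _ (fun b => ?_) (fun a => ?_)
    (fun a => ?_) (fun hc => ?_) (fun hc => ?_) (fun hc => ?_)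
  · rw [smul_sub, smul_add, smul_sub, smul_add, PresBimod.scalar_right_smul,
      PresBimod.scalar_right_smul, ← PresBimod.smul_cup, ← PresBimod.smul_gen,
      PresBimod.smul_one_eq, smul_comm (ιB b) (z * laminv), smul_comm (ιB b) z]
  · rw [PresBimod.smul_right_smul, op_smul_op_smul, t.comm_g, PresBimod.gen_mul, smul_smul,
      smul_smul, t.comm_g]
  · rw [PresBimod.smul_right_smul, op_smul_op_smul, t.gi_comm, PresBimod.cup_mul, smul_smul,
      smul_smul, t.gi_comm]
  · have P := t.pair hc
    rw [PresBimod.smul_right_smul, op_smul_op_smul, PresBimod.smul_right_smul, op_smul_op_smul,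
      P.gf, P.gif, mul_assoc, mul_assoc, PresBimod.gen_mul, PresBimod.cup_mul,
      PresBimod.gen_e_mul, smul_smul, smul_smul, smul_smul, smul_smul, P.ghigi, mul_assoc]
  · have P := t.pair hc
    rw [PresBimod.smul_right_smul, op_smul_op_smul, smul_smul, smul_smul, P.fg, P.fgi,
      mul_smul, ← PresBimod.gen_mul, PresBimod.mul_e_smul_gen, mul_smul (_ * e),
          ← PresBimod.cup_mul,
      ← mul_assoc, ← mul_assoc, P.symm.ghigi]
  · have P := t.pair hc
    rw [PresBimod.smul_right_smul, op_smul_op_smul, smul_smul, P.fgi, mul_smul, P.gif,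
      ← PresBimod.cup_mul, ← mul_assoc,
      ← mul_assoc, P.fst.g_g, sub_mul, sub_mul, add_mul, add_mul, smul_mul_assoc, smul_mul_assoc,
      smul_mul_assoc, smul_mul_assoc, one_mul, P.fef, ← P.gif]
    simp only [MulOpposite.op_sub, MulOpposite.op_add, MulOpposite.op_smul, sub_smul, add_smul,
      smul_sub, smul_add, smul_assoc, smul_comm _ z, smul_comm _ (z * laminv),
      PresBimod.mul_e_smul_cup_e, ← PresBimod.mul_e_smul_gen, PresBimod.smul_one_eq,
      ← PresBimod.smul_cup, ← PresBimod.smul_gen, smul_smul (ιB f * e), P.fef]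

end Tower

end Tower

section Operators

variable {R C B A : Type u} [CommRing R] [Ring C] [Algebra R C] [Ring B] [Algebra R B] [Ring A]
  [Algebra R A]

/-- Bimodule maps `T`, `K`, `θ` given by the universal property of a tower, and the operators `𝔾`,
`𝔼` on `PresBimod` through which the next pair of generators acts. -/
structure Operators (lam laminv del z : R) (c : Prop) (ιC : C →ₐ[R] B) (ιB : B →ₐ[R] A) (h hi f : B)
    (g gi e : A) (T : A →ₗ[R] A) (K : A →ₗ[R] B) (θ : A →ₗ[R] PresBimod ιB gi e)
    (𝔾 𝔼 : PresBimod ιB gi e →ₗ[R] PresBimod ιB gi e) : Prop where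
  tower : Tower lam laminv del z c ιC ιB h hi f g gi e
  T_one : T 1 = laminv • 1
  T_g : T g = e
  T_e : T e = gi
  T_left : ∀ b v, T (ιB b * v) = ιB b * T v
  T_right : ∀ v b, T (v * ιB b) = T v * ιB b
  K_one : K 1 = del • 1
  K_g : K g = lam • 1
  K_e : K e = 1
  K_left : ∀ b v, K (ιB b * v) = b * K v
  K_right : ∀ v b, K (v * ιB b) = K v * b
  θ_one : θ 1 = PresBimod.one ιB gi e + (z * laminv) • PresBimod.cup ιB gi e
    - z • PresBimod.gen ιB gi e
  θ_g : θ g = g • (PresBimod.gen ιB gi e <• g)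
  θ_e : θ e = gi • (PresBimod.cup ιB gi e <• gi)
  θ_left : ∀ b v, θ (ιB b * v) = ιB b • θ v
  θ_right : ∀ v b, θ (v * ιB b) = θ v <• ιB b
  opG_right : ∀ x (a : A), 𝔾 (x <• a) = 𝔾 x <• a
  opG_one : ∀ a : A, 𝔾 (a • PresBimod.one ιB gi e) = PresBimod.gen ιB gi e <• a
  opG_gen : ∀ a : A, 𝔾 (a • PresBimod.gen ιB gi e) = θ a
  opG_cup : ∀ a : A, 𝔾 (a • PresBimod.cup ιB gi e) = T a • PresBimod.cup ιB gi e
  opE_right : ∀ x (a : A), 𝔼 (x <• a) = 𝔼 x <• a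
  opE_one : ∀ a : A, 𝔼 (a • PresBimod.one ιB gi e) = PresBimod.cup ιB gi e <• a
  opE_gen : ∀ a : A, 𝔼 (a • PresBimod.gen ιB gi e) = PresBimod.cup ιB gi e <• T a
  opE_cup : ∀ a : A, 𝔼 (a • PresBimod.cup ιB gi e) = ιB (K a) • PresBimod.cup ιB gi e

variable {lam laminv del z : R} {c : Prop} {ιC : C →ₐ[R] B} {ιB : B →ₐ[R] A} {h hi f : B}
    {g gi e : A}

theorem Tower.braiding_mul_g_e (t : Tower lam laminv del z c ιC ιB h hi f g gi e)
    {T : A →ₗ[R] A} {θ : A →ₗ[R] PresBimod ιB gi e}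
    (T_one : T 1 = laminv • 1) (T_g : T g = e) (T_e : T e = gi)
    (T_left : ∀ b v, T (ιB b * v) = ιB b * T v) (T_right : ∀ v b, T (v * ιB b) = T v * ιB b)
    (θ_one : θ 1 = PresBimod.one ιB gi e + (z * laminv) • PresBimod.cup ιB gi e
      - z • PresBimod.gen ιB gi e)
    (θ_g : θ g = g • (PresBimod.gen ιB gi e <• g)) (θ_e : θ e = gi • (PresBimod.cup ιB gi e <• gi))
    (θ_left : ∀ b v, θ (ιB b * v) = ιB b • θ v) (θ_right : ∀ v b, θ (v * ιB b) = θ v <• ιB b)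
    (a : A) : θ (a * g) <• e = T a • (PresBimod.cup ιB gi e <• e) := by
  have hge : θ g <• e = laminv • (PresBimod.cup ιB gi e <• e) := by
    rw [θ_g, PresBimod.smul_right_smul, op_smul_op_smul, t.singleA.g_e, MulOpposite.op_smul,
      smul_assoc, PresBimod.gen_right, smul_comm g, smul_smul, t.singleA.g_gi, one_smul]
  have hee : θ e <• e = lam • gi • (PresBimod.cup ιB gi e <• e) := by
    rw [θ_e, PresBimod.smul_right_smul, op_smul_op_smul, t.singleA.gi_e t.hlam,
      MulOpposite.op_smul, smul_assoc, smul_comm gi]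
  refine t.induct_right (p := fun a => θ (a * g) <• e = T a • (PresBimod.cup ιB gi e <• e))
    ?_ ?_ ?_ ?_ ?_ ?_ ?_ ?_ (fun hc => ?_) (fun hc => ?_) (fun hc => ?_) a
  · simp
  · intro x y hx hy
    rw [add_mul, map_add, smul_add, hx, hy, map_add, add_smul]
  · intro r x hx
    rw [smul_mul_assoc, map_smul, PresBimod.scalar_right_smul, hx, map_smul, smul_assoc]
  · intro b x hx
    rw [mul_assoc, θ_left, PresBimod.smul_right_smul, hx, T_left, mul_smul]
  · intro x a hx
    rw [mul_assoc, ← t.comm_g, ← mul_assoc, θ_right, op_smul_op_smul, ← t.comm_e, ← op_smul_op_smul,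
      hx, PresBimod.smul_right_smul, op_smul_op_smul, t.comm_e, PresBimod.cup_mul, T_right,
          mul_smul]
  · rw [one_mul, hge, T_one, smul_assoc, one_smul]
  · rw [t.singleA.g_g, map_sub, map_add, map_smul, map_smul, θ_one, T_g, PresBimod.both_cup,
      PresBimod.smul_one_eq]
    simp only [smul_add, smul_sub, PresBimod.scalar_right_smul, hge, hee, PresBimod.gen_right]
    generalize gi • (PresBimod.cup ιB gi e <• e) = X
    generalize PresBimod.cup ιB gi e <• e = Y
    generalize PresBimod.one ιB gi e <• e = Z
    linear_combination (norm := module) (z * t.hlam) • X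
  · rw [t.singleA.e_g, map_smul, PresBimod.scalar_right_smul, hee, smul_smul, mul_comm, t.hlam,
      one_smul, T_e]
  · have P := t.pair hc
    rw [P.braid, θ_right, θ_left, θ_g, T_right, T_g, op_smul_op_smul, PresBimod.smul_right_smul,
      PresBimod.smul_right_smul, op_smul_op_smul, ← mul_assoc, P.ghe, PresBimod.gen_mul,
      PresBimod.gen_right, smul_smul, smul_smul, smul_smul, P.hgf, P.efgi]
  · have P := t.pair hc
    rw [P.ehg, θ_right, θ_e, T_right, T_e, op_smul_op_smul, PresBimod.smul_right_smul,
      op_smul_op_smul, ← mul_assoc, P.gife, PresBimod.cup_mul, smul_smul]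
  · have P := t.pair hc
    rw [P.efg, θ_right, θ_e, T_right, T_e, op_smul_op_smul, PresBimod.smul_right_smul,
      op_smul_op_smul, ← mul_assoc, P.gihie, PresBimod.cup_mul, smul_smul]

theorem Tower.twist_mul_g_e (t : Tower lam laminv del z c ιC ιB h hi f g gi e)
    {T : A →ₗ[R] A} {K : A →ₗ[R] B}
    (T_one : T 1 = laminv • 1) (T_g : T g = e) (T_e : T e = gi)
    (T_left : ∀ b v, T (ιB b * v) = ιB b * T v) (T_right : ∀ v b, T (v * ιB b) = T v * ιB b)
    (K_one : K 1 = del • 1) (K_g : K g = lam • 1) (K_e : K e = 1)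
    (K_left : ∀ b v, K (ιB b * v) = b * K v) (K_right : ∀ v b, K (v * ιB b) = K v * b)
    (a : A) : T (a * g) * e = ιB (K a) * e := by
  refine t.induct_right (p := fun a => T (a * g) * e = ιB (K a) * e)
    ?_ ?_ ?_ ?_ ?_ ?_ ?_ ?_ (fun hc => ?_) (fun hc => ?_) (fun hc => ?_) a
  · simp
  · intro x y hx hy
    simp only [add_mul, map_add, hx, hy]
  · intro r x hx
    simp only [smul_mul_assoc, map_smul, hx]
  · intro b x hx
    rw [mul_assoc, T_left, mul_assoc, hx, K_left, map_mul, mul_assoc]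
  · intro x a hx
    rw [mul_assoc, ← t.comm_g, ← mul_assoc, T_right, mul_assoc, ← t.comm_e, ← mul_assoc,
      hx, mul_assoc, t.comm_e, K_right, map_mul, mul_assoc]
  · rw [one_mul, T_g, K_one, t.singleA.e_e]
    simp
  · rw [t.singleA.g_g, map_sub, map_add, map_smul, map_smul, T_one, T_e, T_g, K_g]
    simp only [sub_mul, add_mul, smul_mul_assoc, one_mul, t.singleA.e_e, t.singleA.gi_e t.hlam,
      map_smul, map_one]
    linear_combination (norm := module) (z • t.hlam) • e + t.hskein • e
  · rw [t.singleA.e_g, map_smul, T_e, smul_mul_assoc, t.singleA.gi_e t.hlam, smul_smul, mul_comm,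
      t.hlam, K_e, map_one, one_smul, one_mul]
  · have P := t.pair hc
    rw [P.braid, T_right, T_left, T_g, mul_assoc, mul_assoc, ← mul_assoc e, P.ehe,
      K_right, K_g]
    simp
  · have P := t.pair hc
    rw [P.ehg, T_right, T_e, P.gife, K_right, K_e, one_mul]
  · have P := t.pair hc
    rw [P.efg, T_right, T_e, P.gihie, K_right, K_e, one_mul]

theorem Tower.exists_operators (t : Tower lam laminv del z c ιC ιB h hi f g gi e) :
    ∃ T K θ 𝔾 𝔼, Operators lam laminv del z c ιC ιB h hi f g gi e T K θ 𝔾 𝔼 := by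
  obtain ⟨T, T1, Tg, Te, Tl, Tr⟩ := t.exists_closure_twist
  obtain ⟨K, K1, Kg, Ke, Kl, Kr⟩ := t.exists_contraction
  obtain ⟨θ, θ1, θg, θe, θl, θr⟩ := t.exists_braiding
  let N := PresBimod ιB gi e
  let Q : Aᵐᵒᵖ →ₐ[R] Module.End R N := Algebra.lsmul R R N
  let rr (x : N) : A →ₗ[R] N :=
    { toFun := fun a => x <• a
      map_add' := fun a b => by rw [MulOpposite.op_add, add_smul]
      map_smul' := fun r a => by rw [MulOpposite.op_smul, smul_assoc]; rfl }
  let ll (x : N) : A →ₗ[R] N := LinearMap.toSpanSingleton A N x |>.restrictScalars R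
  refine Exists.elim (PresBimod.exists_lift (ι := ιB) (gi := gi) (e := e) Q
    (rr (PresBimod.gen ιB gi e)) θ (ll (PresBimod.cup ιB gi e) ∘ₗ T) (fun x a => ?_)
    (fun x b => θr x b) (fun x b => ?_) (fun x => ?_) (fun x => ?_) (fun x => ?_)) fun 𝔾 hG => ?_
  · exact (op_smul_op_smul _ _ _).symm
  · change T (x * ιB b) • PresBimod.cup ιB gi e = (T x • PresBimod.cup ιB gi e) <• ιB b
    rw [PresBimod.smul_right_smul, ← PresBimod.smul_cup, smul_smul, Tr]
  · change θ x <• e = (T (x * gi) • PresBimod.cup ιB gi e) <• e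
    rw [PresBimod.smul_right_smul, ← t.braiding_mul_g_e T1 Tg Te Tl Tr θ1 θg θe θl θr, mul_assoc,
      t.singleA.gi_g, mul_one]
  · obtain ⟨b, hb⟩ := t.exists_mul_e x
    change θ (x * e) = (T (x * e) • PresBimod.cup ιB gi e) <• gi
    rw [hb, θl, θe, Tl, Te, mul_smul, PresBimod.smul_right_smul, PresBimod.smul_right_smul]
  · obtain ⟨b, hb⟩ := t.exists_mul_e x
    change (T (x * e) • PresBimod.cup ιB gi e) <• e = PresBimod.gen ιB gi e <• (x * e)
    rw [hb, Tl, Te, PresBimod.gen_mul, PresBimod.gen_right, mul_smul, PresBimod.smul_right_smul,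
      PresBimod.smul_right_smul]
  refine Exists.elim (PresBimod.exists_lift (ι := ιB) (gi := gi) (e := e) Q
    (rr (PresBimod.cup ιB gi e)) (rr (PresBimod.cup ιB gi e) ∘ₗ T)
    (ll (PresBimod.cup ιB gi e) ∘ₗ ιB.toLinearMap ∘ₗ K) (fun x a => ?_)
    (fun x b => ?_) (fun x b => ?_) (fun x => ?_) (fun x => ?_) (fun x => ?_)) fun 𝔼 hE => ?_
  · exact (op_smul_op_smul _ _ _).symm
  · change PresBimod.cup ιB gi e <• T (x * ιB b) = PresBimod.cup ιB gi e <• T x <• ιB b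
    rw [op_smul_op_smul, Tr]
  · change ιB (K (x * ιB b)) • PresBimod.cup ιB gi e =
      (ιB (K x) • PresBimod.cup ιB gi e) <• ιB b
    rw [PresBimod.smul_right_smul, ← PresBimod.smul_cup, smul_smul, Kr, map_mul]
  · change PresBimod.cup ιB gi e <• T x <• e =
      (ιB (K (x * gi)) • PresBimod.cup ιB gi e) <• e
    rw [PresBimod.smul_right_smul, ← PresBimod.cup_mul, op_smul_op_smul,
      ← t.twist_mul_g_e T1 Tg Te Tl Tr K1 Kg Ke Kl Kr, mul_assoc, t.singleA.gi_g, mul_one]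
  · obtain ⟨b, hb⟩ := t.exists_mul_e x
    change PresBimod.cup ιB gi e <• T (x * e) =
      (ιB (K (x * e)) • PresBimod.cup ιB gi e) <• gi
    rw [hb, Tl, Kl, Te, Ke, PresBimod.cup_mul, PresBimod.smul_right_smul, mul_one]
  · obtain ⟨b, hb⟩ := t.exists_mul_e x
    change (ιB (K (x * e)) • PresBimod.cup ιB gi e) <• e = PresBimod.cup ιB gi e <• (x * e)
    rw [hb, Kl, Ke, PresBimod.cup_mul, PresBimod.smul_right_smul, mul_one]
  exact ⟨T, K, θ, 𝔾, 𝔼, t, T1, Tg, Te, Tl, Tr, K1, Kg, Ke, Kl, Kr, θ1, θg, θe, θl, θr, hG.1,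
    hG.2.1, hG.2.2.1, hG.2.2.2, hE.1, hE.2.1, hE.2.2.1, hE.2.2.2⟩

end Operators

section OperatorRelations

variable {R C B A : Type u} [CommRing R] [Ring C] [Algebra R C] [Ring B] [Algebra R B] [Ring A]
  [Algebra R A]

namespace Operators

variable {lam laminv del z : R} {c : Prop} {ιC : C →ₐ[R] B} {ιB : B →ₐ[R] A} {h hi f : B}
    {g gi e : A} {T : A →ₗ[R] A} {K : A →ₗ[R] B} {θ : A →ₗ[R] PresBimod ιB gi e}
    {𝔾 𝔼 : PresBimod ιB gi e →ₗ[R] PresBimod ιB gi e}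
    (o : Operators lam laminv del z c ιC ιB h hi f g gi e T K θ 𝔾 𝔼)
include o

theorem opG_one_right (x : A) :
    𝔾 (PresBimod.one ιB gi e <• x) = PresBimod.gen ιB gi e <• x := by
  rw [← PresBimod.smul_one_eq, o.opG_one]

theorem opG_gen_right (a x : A) : 𝔾 (a • (PresBimod.gen ιB gi e <• x)) = θ a <• x := by
  rw [← PresBimod.smul_right_smul, o.opG_right, o.opG_gen]

theorem opG_cup_right (a x : A) :
    𝔾 (a • (PresBimod.cup ιB gi e <• x)) = T a • (PresBimod.cup ιB gi e <• x) := by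
  rw [← PresBimod.smul_right_smul, o.opG_right, o.opG_cup, PresBimod.smul_right_smul]

theorem opE_one_right (x : A) :
    𝔼 (PresBimod.one ιB gi e <• x) = PresBimod.cup ιB gi e <• x := by
  rw [← PresBimod.smul_one_eq, o.opE_one]

theorem opE_gen_right (a x : A) :
    𝔼 (a • (PresBimod.gen ιB gi e <• x)) = PresBimod.cup ιB gi e <• (T a * x) := by
  rw [← PresBimod.smul_right_smul, o.opE_right, o.opE_gen, op_smul_op_smul]

theorem opE_cup_right (a x : A) :
    𝔼 (a • (PresBimod.cup ιB gi e <• x)) = ιB (K a) • (PresBimod.cup ιB gi e <• x) := by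
  rw [← PresBimod.smul_right_smul, o.opE_right, o.opE_cup, PresBimod.smul_right_smul]

theorem opG_left (b : B) (x : PresBimod ιB gi e) : 𝔾 (ιB b • x) = ιB b • 𝔾 x := by
  refine PresBimod.induction_on x (fun x y hx hy => ?_) (fun a => ?_) (fun a a' => ?_)
    fun a a' => ?_
  · rw [smul_add, map_add, map_add, smul_add, hx, hy]
  · rw [PresBimod.smul_one_right, o.opG_one_right, o.opG_one_right, PresBimod.gen_mul]
  · rw [smul_smul, o.opG_gen_right, o.opG_gen_right, o.θ_left, PresBimod.smul_right_smul]
  · rw [smul_smul, o.opG_cup_right, o.opG_cup_right, o.T_left, mul_smul]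

theorem opE_left (b : B) (x : PresBimod ιB gi e) : 𝔼 (ιB b • x) = ιB b • 𝔼 x := by
  refine PresBimod.induction_on x (fun x y hx hy => ?_) (fun a => ?_) (fun a a' => ?_)
    fun a a' => ?_
  · rw [smul_add, map_add, map_add, smul_add, hx, hy]
  · rw [PresBimod.smul_one_right, o.opE_one_right, o.opE_one_right, PresBimod.cup_mul]
  · rw [smul_smul, o.opE_gen_right, o.opE_gen_right, o.T_left, mul_assoc, PresBimod.cup_mul]
  · rw [smul_smul, o.opE_cup_right, o.opE_cup_right, o.K_left, map_mul, mul_smul]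

theorem exists_opE_eq (x : PresBimod ιB gi e) : ∃ a : A, 𝔼 x = PresBimod.cup ιB gi e <• a := by
  refine PresBimod.induction_on x ?_ (fun a => ⟨a, o.opE_one_right a⟩)
    (fun a a' => ⟨_, o.opE_gen_right a a'⟩)
    fun a a' => ⟨ιB (K a) * a', by rw [o.opE_cup_right, PresBimod.cup_mul]⟩
  rintro x y ⟨a, ha⟩ ⟨a', ha'⟩
  exact ⟨a + a', by rw [map_add, ha, ha', MulOpposite.op_add, add_smul]⟩

theorem exists_e_smul_eq (x : PresBimod ιB gi e) :
    ∃ a : A, e • x = e • (PresBimod.cup ιB gi e <• a) := by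
  refine PresBimod.induction_on x ?_ (fun a => ⟨e * a, ?_⟩) (fun a a' => ?_) fun a a' => ?_
  · rintro x y ⟨a, ha⟩ ⟨a', ha'⟩
    exact ⟨a + a', by rw [smul_add, ha, ha', MulOpposite.op_add, add_smul, smul_add]⟩
  · have := PresBimod.mul_e_smul_cup_e (ι := ιB) (gi := gi) (e := e) 1 a
    rw [one_mul] at this
    rw [this, PresBimod.smul_one_right]
  · obtain ⟨b, hb⟩ := o.tower.exists_e_mul a
    have := PresBimod.mul_e_smul_gen (ι := ιB) (gi := gi) (e := e) 1 (ιB b * a')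
    rw [one_mul] at this
    exact ⟨gi * (ιB b * a'), by rw [smul_smul, hb, mul_smul, ← PresBimod.gen_mul, this]⟩
  · obtain ⟨b, hb⟩ := o.tower.exists_e_mul a
    exact ⟨ιB b * a', by rw [smul_smul, hb, mul_smul, ← PresBimod.cup_mul]⟩

/-- Right equivariant endomorphisms, equivariant on the left under `B`, are determined by seven
values. -/
theorem ext {P Q : Module.End R (PresBimod ιB gi e)} (hP : ∀ x (a : A), P (x <• a) = P x <• a)
    (hQ : ∀ x (a : A), Q (x <• a) = Q x <• a) (hP' : ∀ b x, P (ιB b • x) = ιB b • P x)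
    (hQ' : ∀ b x, Q (ιB b • x) = ιB b • Q x)
    (hu : P (PresBimod.one ιB gi e) = Q (PresBimod.one ιB gi e))
    (hG1 : P ((1 : A) • PresBimod.gen ιB gi e) = Q ((1 : A) • PresBimod.gen ιB gi e))
    (hGg : P (g • PresBimod.gen ιB gi e) = Q (g • PresBimod.gen ιB gi e))
    (hGe : P (e • PresBimod.gen ιB gi e) = Q (e • PresBimod.gen ιB gi e))
    (hE1 : P ((1 : A) • PresBimod.cup ιB gi e) = Q ((1 : A) • PresBimod.cup ιB gi e))
    (hEg : P (g • PresBimod.cup ιB gi e) = Q (g • PresBimod.cup ιB gi e))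
    (hEe : P (e • PresBimod.cup ιB gi e) = Q (e • PresBimod.cup ιB gi e)) : P = Q := by
  ext x
  refine PresBimod.induction_on x (fun x y hx hy => ?_) (fun a => ?_) (fun a a' => ?_)
    fun a a' => ?_
  · rw [map_add, map_add, hx, hy]
  · rw [hP, hQ, hu]
  · rw [← PresBimod.smul_right_smul, hP, hQ]
    congr 1
    refine o.tower.induct (p := fun a => P (a • PresBimod.gen ιB gi e) =
      Q (a • PresBimod.gen ιB gi e)) ?_ ?_ ?_ ?_ ?_ hG1 hGg hGe a
    · simp
    · intro x y hx hy
      rw [add_smul, map_add, map_add, hx, hy]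
    · intro r x hx
      rw [smul_assoc, LinearMap.map_smul P, LinearMap.map_smul Q, hx]
    · intro b x hx
      rw [mul_smul, hP', hQ', hx]
    · intro x b hx
      rw [mul_smul, PresBimod.smul_gen, ← PresBimod.smul_right_smul, hP, hQ, hx]
  · rw [← PresBimod.smul_right_smul, hP, hQ]
    congr 1
    refine o.tower.induct (p := fun a => P (a • PresBimod.cup ιB gi e) =
      Q (a • PresBimod.cup ιB gi e)) ?_ ?_ ?_ ?_ ?_ hE1 hEg hEe a
    · simp
    · intro x y hx hy
      rw [add_smul, map_add, map_add, hx, hy]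
    · intro r x hx
      rw [smul_assoc, LinearMap.map_smul P, LinearMap.map_smul Q, hx]
    · intro b x hx
      rw [mul_smul, hP', hQ', hx]
    · intro x b hx
      rw [mul_smul, PresBimod.smul_cup, ← PresBimod.smul_right_smul, hP, hQ, hx]

/-- Right equivariant endomorphisms, equivariant on the left under `C`, are determined by thirteen
values. -/
theorem ext_left {P Q : Module.End R (PresBimod ιB gi e)}
    (hP : ∀ x (a : A), P (x <• a) = P x <• a)
    (hQ : ∀ x (a : A), Q (x <• a) = Q x <• a) (hP' : ∀ b x, P (ιB (ιC b) • x) = ιB (ιC b) • P x)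
    (hQ' : ∀ b x, Q (ιB (ιC b) • x) = ιB (ιC b) • Q x)
    (hu : P (PresBimod.one ιB gi e) = Q (PresBimod.one ιB gi e))
    (hG1 : P ((1 : A) • PresBimod.gen ιB gi e) = Q ((1 : A) • PresBimod.gen ιB gi e))
    (hGg : P (g • PresBimod.gen ιB gi e) = Q (g • PresBimod.gen ιB gi e))
    (hGe : P (e • PresBimod.gen ιB gi e) = Q (e • PresBimod.gen ιB gi e))
    (hE1 : P ((1 : A) • PresBimod.cup ιB gi e) = Q ((1 : A) • PresBimod.cup ιB gi e))
    (hEg : P (g • PresBimod.cup ιB gi e) = Q (g • PresBimod.cup ιB gi e))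
    (hEe : P (e • PresBimod.cup ιB gi e) = Q (e • PresBimod.cup ιB gi e))
    (hGhg : c → P ((ιB h * g) • PresBimod.gen ιB gi e) = Q ((ιB h * g) • PresBimod.gen ιB gi e))
    (hGhe : c → P ((ιB h * e) • PresBimod.gen ιB gi e) = Q ((ιB h * e) • PresBimod.gen ιB gi e))
    (hGfe : c → P ((ιB f * e) • PresBimod.gen ιB gi e) = Q ((ιB f * e) • PresBimod.gen ιB gi e))
    (hEhg : c → P ((ιB h * g) • PresBimod.cup ιB gi e) = Q ((ιB h * g) • PresBimod.cup ιB gi e))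
    (hEhe : c → P ((ιB h * e) • PresBimod.cup ιB gi e) = Q ((ιB h * e) • PresBimod.cup ιB gi e))
    (hEfe : c → P ((ιB f * e) • PresBimod.cup ιB gi e) = Q ((ιB f * e) • PresBimod.cup ιB gi e)) :
      P = Q := by
  ext x
  refine PresBimod.induction_on x (fun x y hx hy => ?_) (fun a => ?_) (fun a a' => ?_)
    fun a a' => ?_
  · rw [map_add, map_add, hx, hy]
  · rw [hP, hQ, hu]
  · rw [← PresBimod.smul_right_smul, hP, hQ]
    congr 1
    refine o.tower.induct_left (p := fun a => P (a • PresBimod.gen ιB gi e) =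
      Q (a • PresBimod.gen ιB gi e)) ?_ ?_ ?_ ?_ ?_ hG1 hGg hGe hGhg hGhe hGfe a
    · simp
    · intro x y hx hy
      rw [add_smul, map_add, map_add, hx, hy]
    · intro r x hx
      rw [smul_assoc, LinearMap.map_smul P, LinearMap.map_smul Q, hx]
    · intro b x hx
      rw [mul_smul, hP', hQ', hx]
    · intro x b hx
      rw [mul_smul, PresBimod.smul_gen, ← PresBimod.smul_right_smul, hP, hQ, hx]
  · rw [← PresBimod.smul_right_smul, hP, hQ]
    congr 1
    refine o.tower.induct_left (p := fun a => P (a • PresBimod.cup ιB gi e) =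
      Q (a • PresBimod.cup ιB gi e)) ?_ ?_ ?_ ?_ ?_ hE1 hEg hEe hEhg hEhe hEfe a
    · simp
    · intro x y hx hy
      rw [add_smul, map_add, map_add, hx, hy]
    · intro r x hx
      rw [smul_assoc, LinearMap.map_smul P, LinearMap.map_smul Q, hx]
    · intro b x hx
      rw [mul_smul, hP', hQ', hx]
    · intro x b hx
      rw [mul_smul, PresBimod.smul_cup, ← PresBimod.smul_right_smul, hP, hQ, hx]

theorem T_gi : T gi = e - z • gi + (z * laminv) • 1 := by
  rw [o.tower.singleA.gi_eq, map_add, map_sub, map_smul, map_smul, o.T_g, o.T_e, o.T_one, smul_smul,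
    ← o.tower.singleA.gi_eq]

theorem K_gi : K gi = laminv • 1 := by
  rw [o.tower.singleA.gi_eq, map_add, map_sub, map_smul, map_smul, o.K_g, o.K_e, o.K_one]
  linear_combination (norm := module) -o.tower.hskein • (1 : B)

theorem opG_gen_one : 𝔾 (PresBimod.gen ιB gi e) = θ 1 := by
  simpa using o.opG_gen 1

theorem opG_one_one : 𝔾 (PresBimod.one ιB gi e) = PresBimod.gen ιB gi e := by
  simpa using o.opG_one 1

theorem opG_cup_one : 𝔾 (PresBimod.cup ιB gi e) = laminv • PresBimod.cup ιB gi e := by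
  simpa [o.T_one] using o.opG_cup 1

theorem opG_cup_one_right (x : A) : 𝔾 (PresBimod.cup ιB gi e <• x) =
    laminv • (PresBimod.cup ιB gi e <• x) := by
  rw [o.opG_right, o.opG_cup_one, PresBimod.scalar_right_smul]

theorem opE_gen_one : 𝔼 (PresBimod.gen ιB gi e) = laminv • PresBimod.cup ιB gi e := by
  simpa [o.T_one] using o.opE_gen 1

theorem opE_one_one : 𝔼 (PresBimod.one ιB gi e) = PresBimod.cup ιB gi e := by
  simpa using o.opE_one 1

theorem opE_cup_one : 𝔼 (PresBimod.cup ιB gi e) = del • PresBimod.cup ιB gi e := by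
  simpa [o.K_one] using o.opE_cup 1

theorem opE_cup_one_right (x : A) : 𝔼 (PresBimod.cup ιB gi e <• x) =
    del • (PresBimod.cup ιB gi e <• x) := by
  rw [o.opE_right, o.opE_cup_one, PresBimod.scalar_right_smul]

theorem g_gen_e : g • (PresBimod.gen ιB gi e <• e) = PresBimod.cup ιB gi e <• e := by
  rw [PresBimod.gen_right, smul_smul, o.tower.singleA.g_gi, one_smul]

theorem gi_smul (x : PresBimod ιB gi e) : gi • x = g • x - z • e • x + z • x := by
  have := congrArg (fun a : A => a • x) o.tower.singleA.gi_eq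
  simpa only [add_smul, sub_smul, smul_assoc, one_smul] using this

theorem opG_opG : 𝔾 * 𝔾 = (1 + (z * laminv) • 𝔼 - z • 𝔾 : Module.End R (PresBimod ιB gi e)) := by
  have hz := o.tower.hskein
  have hl := o.tower.hlam
  refine o.ext ?_ ?_ ?_ ?_ ?_ ?_ ?_ ?_ ?_ ?_ ?_
  · simp [o.opG_right]
  · intro x a
    simp [o.opG_right, o.opE_right, PresBimod.scalar_right_smul, smul_sub, smul_add]
  · simp [o.opG_left]
  · intro b x
    simp [o.opG_left, o.opE_left, smul_sub, smul_add, smul_comm _ (ιB b)]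
  · simp [o.opG_gen_one, o.opG_one_one, o.opE_one_one, o.θ_one]
  · simp [o.opG_gen_one, o.opG_one_one, o.opG_cup_one, o.opE_gen_one, o.θ_one]
  · simp [o.opG_gen, o.opE_gen, o.T_g, o.θ_g, o.opG_gen_right, PresBimod.smul_right_smul,
      op_smul_op_smul, o.tower.singleA.g_g, add_smul, sub_smul, smul_comm _ z,
      smul_comm _ (z * laminv), smul_add, smul_sub, o.g_gen_e]
  · rw [Module.End.mul_apply, LinearMap.sub_apply, LinearMap.add_apply, LinearMap.smul_apply,
      LinearMap.smul_apply, o.opG_gen, o.opE_gen, o.θ_e, Module.End.one_apply]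
    simp only [o.opG_cup_right, o.T_e, o.T_gi, PresBimod.left_gen, add_smul, sub_smul, smul_assoc,
      one_smul]
    abel
  · simp only [one_smul, Module.End.mul_apply, LinearMap.sub_apply, LinearMap.add_apply,
      LinearMap.smul_apply, Module.End.one_apply, o.opG_cup_one, o.opE_cup_one, map_smul]
    linear_combination (norm := module)
      (laminv * hz + hl) • PresBimod.cup ιB gi e
  · simp only [Module.End.mul_apply, LinearMap.sub_apply, LinearMap.add_apply,
      LinearMap.smul_apply, Module.End.one_apply, o.opG_cup, o.opE_cup, o.T_g, o.T_e, o.K_g,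
      map_smul, map_one, smul_assoc, one_smul]
    rw [o.gi_smul]
    generalize g • PresBimod.cup ιB gi e = X
    generalize e • PresBimod.cup ιB gi e = Y
    linear_combination (norm := module) (-z) • hl • PresBimod.cup ιB gi e
  · simp only [Module.End.mul_apply, LinearMap.sub_apply, LinearMap.add_apply,
      LinearMap.smul_apply, Module.End.one_apply, o.opG_cup, o.opE_cup, o.T_gi, o.T_e, o.K_e,
      map_one, add_smul, sub_smul, smul_assoc, one_smul]
    abel

theorem opE_opE : 𝔼 * 𝔼 = (del • 𝔼 : Module.End R (PresBimod ιB gi e)) := by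
  ext x
  obtain ⟨a, ha⟩ := o.exists_opE_eq x
  simp [ha, o.opE_right, o.opE_cup_one, PresBimod.scalar_right_smul]

theorem opG_opE : 𝔾 * 𝔼 = (laminv • 𝔼 : Module.End R (PresBimod ιB gi e)) := by
  ext x
  obtain ⟨a, ha⟩ := o.exists_opE_eq x
  simp [ha, o.opG_right, o.opG_cup_one, PresBimod.scalar_right_smul]

theorem opE_opG : 𝔼 * 𝔾 = (laminv • 𝔼 : Module.End R (PresBimod ιB gi e)) := by
  have hz := o.tower.hskein
  have hl := o.tower.hlam
  refine o.ext ?_ ?_ ?_ ?_ ?_ ?_ ?_ ?_ ?_ ?_ ?_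
  · simp [o.opG_right, o.opE_right]
  · simp [o.opE_right, PresBimod.scalar_right_smul]
  · simp [o.opG_left, o.opE_left]
  · intro b x
    simp [o.opE_left, smul_comm _ (ιB b)]
  · simp [o.opG_one_one, o.opE_one_one, o.opE_gen_one]
  · simp only [one_smul, Module.End.mul_apply, LinearMap.smul_apply, o.opG_gen_one, o.opE_gen_one,
      o.opE_one_one, o.opE_cup_one, o.θ_one, map_add, map_sub, map_smul]
    linear_combination (norm := module) (-laminv * hz - hl) • PresBimod.cup ιB gi e
  · simp [o.opG_gen, o.opE_gen, o.T_g, o.θ_g, o.opE_gen_right, o.tower.singleA.e_g]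
  · simp [o.opG_gen, o.opE_gen, o.T_e, o.θ_e, o.opE_cup_right, o.K_gi]
  · simp [o.opG_cup_one, o.opE_cup_one]
  · simp only [Module.End.mul_apply, LinearMap.smul_apply, o.opG_cup, o.opE_cup, o.T_g, o.K_e,
      o.K_g, map_smul, map_one, smul_assoc, one_smul]
    linear_combination (norm := module) (-hl) • PresBimod.cup ιB gi e
  · simp [o.opG_cup, o.opE_cup, o.T_e, o.K_gi, o.K_e]

theorem single : Single lam laminv del z (𝔾 : Module.End R (PresBimod ιB gi e))
    (𝔾 - z • (𝔼 - 1)) 𝔼 := by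
  refine ⟨?_, ?_, o.opE_opE, by simp, o.opG_opE, o.opE_opG⟩
  · rw [mul_sub, mul_smul_comm, mul_sub, mul_one, o.opG_opG, o.opG_opE]
    module
  · rw [sub_mul, smul_mul_assoc, sub_mul, one_mul, o.opG_opG, o.opE_opG]
    module

end Operators

end OperatorRelations

namespace Pair

variable {R S : Type*} [CommRing R] [Ring S] [Algebra R S] {lam laminv del z : R}
  {h hi f g gi e : S} (P : Pair lam laminv del z h hi f g gi e)
include P

theorem ghgi : g * h * gi = hi * g * h := by
  calc g * h * gi = hi * (h * g * h) * gi := by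
        simp only [mul_assoc, P.fst.gi_mul_g_mul]
    _ = hi * g * h := by
        rw [← P.braid]
        simp only [mul_assoc, P.snd.g_gi, mul_one]

theorem gfgi : g * f * gi = hi * e * h := by
  rw [P.gf, mul_assoc, P.fgi, ← mul_assoc, ← mul_assoc, mul_assoc hi, mul_assoc hi, P.efe]

end Pair

section OperatorRelations

variable {R C B A : Type u} [CommRing R] [Ring C] [Algebra R C] [Ring B] [Algebra R B] [Ring A]
  [Algebra R A]

namespace Operators

variable {lam laminv del z : R} {c : Prop} {ιC : C →ₐ[R] B} {ιB : B →ₐ[R] A} {h hi f : B}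
    {g gi e : A} {T : A →ₗ[R] A} {K : A →ₗ[R] B} {θ : A →ₗ[R] PresBimod ιB gi e}
    {𝔾 𝔼 : PresBimod ιB gi e →ₗ[R] PresBimod ιB gi e}
    (o : Operators lam laminv del z c ιC ιB h hi f g gi e T K θ 𝔾 𝔼)
include o

theorem T_mid (b v b') : T (ιB b * v * ιB b') = ιB b * T v * ιB b' := by
  rw [o.T_right, o.T_left]

theorem K_mid (b v b') : K (ιB b * v * ιB b') = b * K v * b' := by
  rw [o.K_right, o.K_left]

theorem opE_e_opE : 𝔼 * Algebra.lsmul R R (PresBimod ιB gi e) e * 𝔼 = 𝔼 := by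
  ext x
  obtain ⟨a, ha⟩ := o.exists_opE_eq x
  simp [ha, o.opE_cup_right, o.K_e]

theorem opG_g_opE : 𝔾 * Algebra.lsmul R R (PresBimod ιB gi e) g * 𝔼 =
    Algebra.lsmul R R (PresBimod ιB gi e) e * 𝔼 := by
  ext x
  obtain ⟨a, ha⟩ := o.exists_opE_eq x
  simp [ha, o.opG_cup_right, o.T_g]

theorem e_opE_e : Algebra.lsmul R R (PresBimod ιB gi e) e * 𝔼 *
    Algebra.lsmul R R (PresBimod ιB gi e) e = Algebra.lsmul R R (PresBimod ιB gi e) e := by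
  ext x
  obtain ⟨a, ha⟩ := o.exists_e_smul_eq x
  simp [ha, o.opE_cup_right, o.K_e]

theorem g_opG_e : Algebra.lsmul R R (PresBimod ιB gi e) g * 𝔾 *
    Algebra.lsmul R R (PresBimod ιB gi e) e = 𝔼 * Algebra.lsmul R R (PresBimod ιB gi e) e := by
  ext x
  obtain ⟨a, ha⟩ := o.exists_e_smul_eq x
  simp [ha, o.opE_cup_right, o.K_e, o.opG_cup_right, o.T_e, smul_smul, o.tower.singleA.g_gi]

theorem smul_right_gi (x : PresBimod ιB gi e) : x <• gi = x <• g - z • (x <• e) + z • x := by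
  have := congrArg (fun a : A => x <• a) o.tower.singleA.gi_eq
  simpa only [MulOpposite.op_add, MulOpposite.op_sub, MulOpposite.op_smul, MulOpposite.op_one,
    add_smul, sub_smul, smul_assoc, one_smul] using this

theorem left_comm_g (b : C) (x : PresBimod ιB gi e) : g • ιB (ιC b) • x = ιB (ιC b) • g • x := by
  rw [smul_smul, o.tower.comm_g, mul_smul]

theorem left_comm_e (b : C) (x : PresBimod ιB gi e) : e • ιB (ιC b) • x = ιB (ιC b) • e • x := by
  rw [smul_smul, o.tower.comm_e, mul_smul]

theorem e_smul_θ_g : e • θ g = laminv • e • PresBimod.cup ιB gi e := by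
  have := PresBimod.mul_e_smul_gen (ι := ιB) (gi := gi) (e := e) 1 g
  rw [one_mul, o.tower.singleA.gi_g, MulOpposite.op_one, one_smul] at this
  rw [o.θ_g, smul_smul, o.tower.singleA.e_g, smul_assoc, this]

theorem e_smul_θ_e : e • θ e = lam • e • (PresBimod.cup ιB gi e <• gi) := by
  rw [o.θ_e, smul_smul, o.tower.singleA.e_gi o.tower.hlam, smul_assoc]

theorem e_smul_θ_one : e • θ 1 = e • PresBimod.one ιB gi e +
    (z * laminv) • e • PresBimod.cup ιB gi e - z • e • (PresBimod.cup ιB gi e <• gi) := by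
  rw [o.θ_one, smul_sub, smul_add, PresBimod.left_gen.symm, smul_comm e, smul_comm e]

theorem θ_mid (b v b') : θ (ιB b * v * ιB b') = ιB b • (θ v <• ιB b') := by
  rw [o.θ_right, o.θ_left, PresBimod.smul_right_smul]

theorem e_opG_g : Algebra.lsmul R R (PresBimod ιB gi e) e * 𝔾 *
    Algebra.lsmul R R (PresBimod ιB gi e) g = Algebra.lsmul R R (PresBimod ιB gi e) e * 𝔼 := by
  have hl := o.tower.hlam
  have s := o.tower.singleA
  refine o.ext_left ?_ ?_ ?_ ?_ ?_ ?_ ?_ ?_ ?_ ?_ ?_ ?_ ?_ ?_ ?_ ?_ ?_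
  · intro x a
    simp only [Module.End.mul_apply, Algebra.lsmul_coe, ← PresBimod.smul_right_smul, o.opG_right]
  · intro x a
    simp only [Module.End.mul_apply, Algebra.lsmul_coe, ← PresBimod.smul_right_smul, o.opE_right]
  · intro b x
    simp only [Module.End.mul_apply, Algebra.lsmul_coe, o.left_comm_g, o.left_comm_e, o.opG_left]
  · intro b x
    simp only [Module.End.mul_apply, Algebra.lsmul_coe, o.left_comm_e, o.opE_left]
  · have := PresBimod.mul_e_smul_gen (ι := ιB) (gi := gi) (e := e) 1 g
    rw [one_mul, s.gi_g, MulOpposite.op_one, one_smul] at this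
    simpa only [Module.End.mul_apply, Algebra.lsmul_coe, o.opG_one, o.opE_one_one] using this
  all_goals simp only [Module.End.mul_apply, Algebra.lsmul_coe, smul_smul, o.opG_gen, o.opE_gen,
    o.opG_cup, o.opE_cup, ← mul_assoc]
  · rw [mul_one, o.e_smul_θ_g, o.T_one, MulOpposite.op_smul, MulOpposite.op_one, smul_assoc,
      one_smul, smul_comm e]
  · rw [s.g_g, map_sub, map_add, map_smul, map_smul, smul_sub, smul_add, smul_comm e,
      smul_comm e, o.e_smul_θ_one, o.e_smul_θ_e, o.e_smul_θ_g, o.T_g, PresBimod.both_cup]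
    generalize e • PresBimod.one ιB gi e = X
    generalize e • PresBimod.cup ιB gi e = Y
    generalize e • (PresBimod.cup ιB gi e <• gi) = Z
    linear_combination (norm := module) z • hl • Z
  · rw [s.g_e, map_smul, smul_comm e, o.e_smul_θ_e, smul_smul, mul_comm laminv, hl, one_smul, o.T_e]
  · rw [mul_one, o.T_g, s.e_e, o.K_one, map_smul, map_one, mul_smul_comm, mul_one]
  · rw [s.g_g, map_sub, map_add, map_smul, map_smul, o.T_one, o.T_g, o.T_e, o.K_g, map_smul,
      map_one,
      mul_sub, mul_add, mul_smul_comm, mul_smul_comm, mul_smul_comm, mul_smul_comm, s.e_e,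
      s.e_gi hl, mul_one]
    congr 1
    linear_combination (norm := module) o.tower.hskein • e + z • hl • e
  · rw [s.g_e, map_smul, o.T_e, mul_smul_comm, s.e_gi hl, o.K_e, map_one, smul_smul,
      mul_comm laminv, hl, one_smul, mul_one]
  · intro hc
    have P := o.tower.pair hc
    rw [P.braid, o.θ_mid, o.θ_g, PresBimod.smul_right_smul, op_smul_op_smul, smul_smul, smul_smul,
      P.ehg, mul_smul, ← PresBimod.gen_mul, ← mul_assoc, P.fgh, PresBimod.gen_mul,
      PresBimod.gen_right, smul_smul, smul_smul, P.efgi, o.T_left, o.T_g, PresBimod.cup_mul,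
      smul_smul]
  · intro hc
    have P := o.tower.pair hc
    rw [P.ghe, o.θ_left, o.θ_e, smul_smul, smul_smul, P.efgi, o.T_left, o.T_e,
      PresBimod.cup_mul, smul_smul]
  · intro hc
    have P := o.tower.pair hc
    rw [P.gfe, o.θ_left, o.θ_e, smul_smul, smul_smul, P.ehigi, o.T_left, o.T_e,
      PresBimod.cup_mul, smul_smul]
  · intro hc
    have P := o.tower.pair hc
    rw [P.braid, o.T_mid, o.T_g, ← mul_assoc, ← mul_assoc, P.ehe, o.K_left, o.K_g, mul_smul_comm,
      mul_one, map_smul, smul_mul_assoc, mul_smul_comm]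
  · intro hc
    have P := o.tower.pair hc
    rw [P.ghe, o.T_left, o.T_e, ← mul_assoc, P.efgi, o.K_left, o.K_e, mul_one]
  · intro hc
    have P := o.tower.pair hc
    rw [P.gfe, o.T_left, o.T_e, ← mul_assoc, P.ehigi, o.K_left, o.K_e, mul_one]

theorem opE_g_opG : 𝔼 * Algebra.lsmul R R (PresBimod ιB gi e) g * 𝔾 =
    𝔼 * Algebra.lsmul R R (PresBimod ιB gi e) e := by
  have hl := o.tower.hlam
  have s := o.tower.singleA
  refine o.ext_left ?_ ?_ ?_ ?_ ?_ ?_ ?_ ?_ ?_ ?_ ?_ ?_ ?_ ?_ ?_ ?_ ?_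
  · intro x a
    simp only [Module.End.mul_apply, Algebra.lsmul_coe, ← PresBimod.smul_right_smul, o.opG_right,
      o.opE_right]
  · intro x a
    simp only [Module.End.mul_apply, Algebra.lsmul_coe, ← PresBimod.smul_right_smul, o.opE_right]
  · intro b x
    simp only [Module.End.mul_apply, Algebra.lsmul_coe, o.left_comm_g, o.opE_left, o.opG_left]
  · intro b x
    simp only [Module.End.mul_apply, Algebra.lsmul_coe, o.left_comm_e, o.opE_left]
  · simp only [Module.End.mul_apply, Algebra.lsmul_coe, o.opG_one_one, o.opE_gen, o.opE_one, o.T_g]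
  all_goals simp only [Module.End.mul_apply, Algebra.lsmul_coe, smul_smul, o.opG_gen, o.opE_gen,
    o.opG_cup, o.opE_cup, ← mul_assoc]
  · rw [mul_one, o.T_e, o.θ_one, smul_sub, smul_add, smul_comm g, smul_comm g, map_sub, map_add,
      LinearMap.map_smul 𝔼, LinearMap.map_smul 𝔼, o.opE_one, o.opE_gen, o.opE_cup, o.T_g, o.K_g,
      map_smul, map_one, smul_assoc, one_smul, o.smul_right_gi]
    generalize PresBimod.cup ιB gi e <• g = X
    generalize PresBimod.cup ιB gi e <• e = Y
    linear_combination (norm := module) z • hl • PresBimod.cup ιB gi e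
  · rw [o.θ_g, smul_smul, o.opE_gen_right, s.g_g, map_sub, map_add, map_smul, map_smul, o.T_one,
      o.T_g, o.T_e, s.e_g, map_smul, o.T_e]
    congr 2
    rw [sub_mul, add_mul, smul_mul_assoc, smul_mul_assoc, smul_mul_assoc, one_mul, s.gi_g, s.e_g,
      s.gi_eq]
    module
  · rw [o.θ_e, smul_smul, s.g_gi, one_smul, o.opE_cup_one_right, s.e_e, map_smul, o.T_e,
      MulOpposite.op_smul, smul_assoc]
  · rw [mul_one, o.T_one, mul_smul_comm, mul_one, map_smul, o.K_g, o.K_e, smul_smul,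
      mul_comm laminv, hl, one_smul]
  · rw [o.T_g, s.g_e, s.e_g]
  · rw [o.T_e, s.g_gi, s.e_e, o.K_one, map_smul K, o.K_e]
  · intro hc
    have P := o.tower.pair hc
    rw [o.θ_left, o.θ_g, smul_smul, smul_smul, o.opE_gen_right, P.braid, o.T_mid, o.T_g, P.ehg,
      o.T_right, o.T_e, P.gif, mul_assoc (ιB h), mul_assoc (ιB h), P.ehg, ← mul_assoc]
  · intro hc
    have P := o.tower.pair hc
    rw [o.θ_left, o.θ_e, smul_smul, smul_smul, o.opE_cup_right, P.ghgi, o.K_mid, o.K_g, P.ehe,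
      map_smul, o.T_e, mul_smul_comm, mul_one, smul_mul_assoc, (o.tower.singleB hc).gi_g, map_smul,
      map_one, smul_assoc, one_smul, MulOpposite.op_smul, smul_assoc]
  · intro hc
    have P := o.tower.pair hc
    rw [o.θ_left, o.θ_e, smul_smul, smul_smul, o.opE_cup_right, P.gfgi, o.K_mid, o.K_e, P.efe,
      o.T_e, mul_one, (o.tower.singleB hc).gi_g, map_one, one_smul]
  · intro hc
    have P := o.tower.pair hc
    rw [o.T_left, o.T_g, ← mul_assoc, P.ghe, P.ehg, o.K_left, o.K_right, o.K_e, mul_one, one_mul]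
  · intro hc
    have P := o.tower.pair hc
    rw [o.T_left, o.T_e, ← mul_assoc, P.ghgi, o.K_mid, o.K_g, P.ehe, map_smul, o.K_e,
      mul_smul_comm, mul_one,
      smul_mul_assoc, (o.tower.singleB hc).gi_g]
  · intro hc
    have P := o.tower.pair hc
    rw [o.T_left, o.T_e, ← mul_assoc, P.gfgi, o.K_mid, o.K_e, P.efe, mul_one,
      (o.tower.singleB hc).gi_g, o.K_e]

theorem g_opG_g : Algebra.lsmul R R (PresBimod ιB gi e) g * 𝔾 *
    Algebra.lsmul R R (PresBimod ιB gi e) g = 𝔾 * Algebra.lsmul R R (PresBimod ιB gi e) g * 𝔾 := by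
  have hl := o.tower.hlam
  have s := o.tower.singleA
  have hgg : g • g • (PresBimod.gen ιB gi e <• g) = PresBimod.gen ιB gi e <• g +
      (z * laminv) • e • PresBimod.cup ιB gi e - z • g • (PresBimod.gen ιB gi e <• g) := by
    have := PresBimod.mul_e_smul_gen (ι := ιB) (gi := gi) (e := e) 1 g
    rw [one_mul, s.gi_g, MulOpposite.op_one, one_smul] at this
    rw [smul_smul, s.g_g, sub_smul, add_smul, smul_assoc, smul_assoc, one_smul, this]
  refine o.ext_left ?_ ?_ ?_ ?_ ?_ ?_ ?_ ?_ ?_ ?_ ?_ ?_ ?_ ?_ ?_ ?_ ?_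
  · intro x a
    simp only [Module.End.mul_apply, Algebra.lsmul_coe, ← PresBimod.smul_right_smul, o.opG_right]
  · intro x a
    simp only [Module.End.mul_apply, Algebra.lsmul_coe, ← PresBimod.smul_right_smul, o.opG_right]
  · intro b x
    simp only [Module.End.mul_apply, Algebra.lsmul_coe, o.left_comm_g, o.opG_left]
  · intro b x
    simp only [Module.End.mul_apply, Algebra.lsmul_coe, o.left_comm_g, o.opG_left]
  · simp only [Module.End.mul_apply, Algebra.lsmul_coe, o.opG_one_one, o.opG_gen, o.opG_one, o.θ_g]
  all_goals simp only [Module.End.mul_apply, Algebra.lsmul_coe, smul_smul, o.opG_gen,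
    o.opG_cup, ← mul_assoc]
  · rw [mul_one, o.θ_g, hgg, o.θ_one, smul_sub, smul_add, smul_comm g (z * laminv), smul_comm g z,
      map_sub, map_add,
      LinearMap.map_smul 𝔾, LinearMap.map_smul 𝔾, o.opG_one, o.opG_gen, o.opG_cup, o.T_g, o.θ_g]
  · have h1 : (g • (PresBimod.gen ιB gi e <• g)) <• g = g • PresBimod.gen ιB gi e +
        (z * laminv) • (PresBimod.cup ιB gi e <• e) - z • g • (PresBimod.gen ιB gi e <• g) := by
      rw [PresBimod.smul_right_smul, op_smul_op_smul, s.g_g, MulOpposite.op_sub, MulOpposite.op_add,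
        MulOpposite.op_smul, MulOpposite.op_smul, MulOpposite.op_one, sub_smul, add_smul,
        smul_assoc, smul_assoc, one_smul, smul_sub, smul_add, smul_comm g (z * laminv),
            smul_comm g z, o.g_gen_e]
    have h2 : g • gi • (PresBimod.cup ιB gi e <• gi) = PresBimod.cup ιB gi e <• gi := by
      rw [smul_smul, s.g_gi, one_smul]
    have h3 : (gi • (PresBimod.cup ιB gi e <• gi)) <• g = gi • PresBimod.cup ιB gi e := by
      rw [PresBimod.smul_right_smul, op_smul_op_smul, s.gi_g, MulOpposite.op_one, one_smul]
    rw [o.θ_g, smul_smul, o.opG_gen_right, s.g_g, map_sub, map_add, map_smul, map_smul, o.θ_one,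
      o.θ_g, o.θ_e]
    simp only [smul_add, smul_sub, smul_comm g z, smul_comm g (z * laminv),
      PresBimod.scalar_right_smul, hgg, h1, h2, h3,
      PresBimod.smul_one_eq]
    rw [o.gi_smul, o.smul_right_gi]
    simp only [smul_add, smul_sub]
    generalize PresBimod.one ιB gi e <• g = X1
    generalize g • PresBimod.cup ιB gi e = X2
    generalize e • PresBimod.cup ιB gi e = X3
    generalize PresBimod.cup ιB gi e <• g = X4
    generalize PresBimod.cup ιB gi e <• e = X5
    generalize PresBimod.gen ιB gi e <• g = X6
    generalize g • PresBimod.gen ιB gi e = X7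
    generalize g • X6 = X8
    module
  · rw [s.g_e, map_smul, smul_comm g, o.θ_e, smul_smul, s.g_gi, one_smul,
      o.opG_cup_one_right]
  · rw [mul_one, o.T_g, s.g_e, o.T_one, mul_smul_comm, mul_one, map_smul, o.T_g]
  · rw [s.g_g, map_sub, map_add, map_smul, map_smul, o.T_one, o.T_g, o.T_e, s.g_e, map_smul, o.T_e,
      mul_sub, mul_add, mul_smul_comm, mul_smul_comm, mul_smul_comm, s.g_gi, s.g_e, mul_one,
          s.gi_eq]
    congr 1
    module
  · rw [s.g_e, map_smul, o.T_e, mul_smul_comm, s.g_gi, o.T_one]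
  · intro hc
    have P := o.tower.pair hc
    rw [P.braid, o.θ_mid, o.θ_left, o.θ_g, PresBimod.smul_right_smul, op_smul_op_smul, smul_smul,
      smul_smul, smul_smul, smul_smul, o.opG_gen_right, P.braid, o.θ_mid, o.θ_g]
    simp only [PresBimod.smul_right_smul, op_smul_op_smul]
    rw [P.braid, mul_smul, ← PresBimod.gen_mul, ← mul_assoc, mul_smul]
  · intro hc
    have P := o.tower.pair hc
    rw [P.ghe, o.θ_left, o.θ_left, o.θ_e, smul_smul, smul_smul, smul_smul, smul_smul,
      o.opG_cup_right, P.ghgi, P.gfgi, o.T_mid, o.T_g]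
  · intro hc
    have P := o.tower.pair hc
    rw [P.gfe, o.θ_left, o.θ_left, o.θ_e, smul_smul, smul_smul, smul_smul, smul_smul,
      o.opG_cup_right, P.ghigi, P.gfgi, o.T_mid, o.T_e]
  · intro hc
    have P := o.tower.pair hc
    rw [P.braid, o.T_mid, o.T_g, o.T_left, o.T_g, ← mul_assoc, ← mul_assoc, P.ghe, o.T_left, o.T_e,
      P.fgi]
  · intro hc
    have P := o.tower.pair hc
    rw [P.ghe, o.T_left, o.T_left, o.T_e, ← mul_assoc, ← mul_assoc, P.ghgi, P.gfgi, o.T_mid, o.T_g]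
  · intro hc
    have P := o.tower.pair hc
    rw [P.gfe, o.T_left, o.T_left, o.T_e, ← mul_assoc, ← mul_assoc, P.ghigi, P.gfgi, o.T_mid, o.T_e]

theorem adjacent : Adjacent (Algebra.lsmul R R (PresBimod ιB gi e) g)
    (Algebra.lsmul R R (PresBimod ιB gi e) e) 𝔾 𝔼 :=
  ⟨o.g_opG_g, o.e_opE_e, o.opE_e_opE, o.g_opG_e, o.opG_g_opE, o.e_opG_g, o.opE_g_opG⟩

end Operators

end OperatorRelations

section Step

variable {R : Type u} [CommRing R] {lam laminv del z : R}

/-- The tower formed by `W_m → W_{m+1} → W_{m+2}`, given the universal property. -/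
theorem tower_of_isUniversal (hlam : lam * laminv = 1) (hskein : laminv - lam = z * (del - 1))
    (m : ℕ) (U : IsUniversal (1 ≤ m) (incl hlam m) (incl hlam (m + 1))
      (gi R lam laminv del z (m + 1) m) (e R lam laminv del z (m + 1) m)
      (g R lam laminv del z (m + 2) (m + 1)) (e R lam laminv del z (m + 2) (m + 1))) :
    Tower lam laminv del z (1 ≤ m) (incl hlam m) (incl hlam (m + 1))
      (g R lam laminv del z (m + 1) m) (gi R lam laminv del z (m + 1) m)
      (e R lam laminv del z (m + 1) m) (g R lam laminv del z (m + 2) (m + 1))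
      (gi R lam laminv del z (m + 2) (m + 1)) (e R lam laminv del z (m + 2) (m + 1)) where
  hlam := hlam
  hskein := hskein
  singleA := single m
  singleB hm := (isRep R lam laminv del z (m + 1)).single m hm (by lia)
  pair := pair hlam m
  comm_g c := (comm_incl hlam m c).1
  comm_e c := (comm_incl hlam m c).2
  genA p hl hr h1 hg he :=
    bimod_gen hlam (m + 1) p (fun a x hx => hl a x hx) (fun a x hx => hr _ _ hx) h1
      (fun _ => hg) (fun _ => he)
  genB p hl hr h1 hg he :=
    bimod_gen hlam m p (fun a x hx => hl a x hx) (fun a x hx => hr _ _ hx) h1 hg he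
  univ := U

/-- A map out of `PresBimod` commuting with the right action and given by `L` on the generators
is left linear. -/
theorem PresBimod.lift_left {A B X : Type u} [Ring A] [Algebra R A] [Ring B] [Algebra R B]
    {ι : B →ₐ[R] A} {gi e : A} [AddCommGroup X] [Module R X]
    {L : A →ₐ[R] Module.End R X} {Q : Aᵐᵒᵖ →ₐ[R] Module.End R X}
    (hcomm : ∀ a b v, L a (Q b v) = Q b (L a v)) {x y w : X} {F : PresBimod ι gi e →ₗ[R] X}
    (F_right : ∀ n (b : A), F (n <• b) = Q (MulOpposite.op b) (F n))
    (F_one : ∀ a : A, F (a • PresBimod.one ι gi e) = L a x)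
    (F_gen : ∀ a : A, F (a • PresBimod.gen ι gi e) = L a y)
    (F_cup : ∀ a : A, F (a • PresBimod.cup ι gi e) = L a w) (a : A) (n : PresBimod ι gi e) :
    F (a • n) = L a (F n) := by
  have key : ∀ (s : PresBimod ι gi e) (s' : X), (∀ a : A, F (a • s) = L a s') → ∀ b c : A,
      F (a • b • (s <• c)) = L a (F (b • (s <• c))) := by
    intro s s' hs b c
    rw [smul_smul, ← smul_right_smul, ← smul_right_smul, F_right, F_right, hs, hs, hcomm, map_mul,
      Module.End.mul_apply]
  refine PresBimod.induction_on n (fun x y hx hy => ?_) (fun b => ?_) (fun b c => ?_)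
    fun b c => ?_
  · rw [smul_add, map_add, map_add, map_add, hx, hy]
  · simpa using key _ _ F_one 1 b
  · exact key _ _ F_gen b c
  · exact key _ _ F_cup b c

theorem isUniversal_succ (hlam : lam * laminv = 1) (m : ℕ)
    (t : Tower lam laminv del z (1 ≤ m) (incl hlam m) (incl hlam (m + 1))
      (g R lam laminv del z (m + 1) m) (gi R lam laminv del z (m + 1) m)
      (e R lam laminv del z (m + 1) m) (g R lam laminv del z (m + 2) (m + 1))
      (gi R lam laminv del z (m + 2) (m + 1)) (e R lam laminv del z (m + 2) (m + 1))) :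
    IsUniversal (1 ≤ m + 1) (incl hlam (m + 1)) (incl hlam (m + 2))
      (gi R lam laminv del z (m + 2) (m + 1)) (e R lam laminv del z (m + 2) (m + 1))
      (g R lam laminv del z (m + 3) (m + 2)) (e R lam laminv del z (m + 3) (m + 2)) := by
  obtain ⟨T, K, θ, 𝔾, 𝔼, o⟩ := t.exists_operators
  intro X _ _ L Q x y w hcomm hx hy hw hr hl hb
  have hr := hr (by lia)
  have hl := hl (by lia)
  have hb := hb (by lia)
  set N := PresBimod (incl hlam (m + 1)) (gi R lam laminv del z (m + 2) (m + 1))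
    (e R lam laminv del z (m + 2) (m + 1)) with hN
  obtain ⟨ψ, hψ, hψ'⟩ := exists_extension (n := m + 2) (Algebra.lsmul R R N) hlam
    (G := 𝔾) (Gi := 𝔾 - z • (𝔼 - 1)) (E := 𝔼) (fun _ => o.single) (fun _ => o.adjacent)
    (fun i h1 h2 => by
      obtain ⟨hg, -, he⟩ := incl_spec (R := R) (del := del) (z := z) hlam (m + 1) i h1 (by lia)
      rw [← hg, ← he]
      exact ⟨⟨LinearMap.ext fun n => (o.opG_left _ n).symm,
        LinearMap.ext fun n => (o.opE_left _ n).symm⟩,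
        LinearMap.ext fun n => (o.opG_left _ n).symm,
        LinearMap.ext fun n => (o.opE_left _ n).symm⟩)
  obtain ⟨ψg, -, ψe⟩ := hψ' (by lia)
  have ψ_incl : ∀ (a : Alg R lam laminv del z (m + 2)) (n : N),
      ψ (incl hlam (m + 2) a) n = a • n := by
    have : ψ.comp (incl hlam (m + 2)) = Algebra.lsmul R R N := by
      refine algHom_ext fun i h1 h2 => ?_
      obtain ⟨k1, k2, k3⟩ := incl_spec (R := R) (del := del) (z := z) hlam (m + 2) i h1 (by lia)
      simp only [AlgHom.comp_apply]
      rw [k1, k2, k3]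
      exact hψ i h1 h2
    intro a n
    exact LinearMap.congr_fun (AlgHom.congr_fun this a) n
  have ψ_right : ∀ (v : Alg R lam laminv del z (m + 3)) (n : N) (a : Alg R lam laminv del z
      (m + 2)),
      ψ v (n <• a) = ψ v n <• a := by
    refine pred_of_eq_top (R := R) (h0 := fun n a => ?_) (hadd := fun v w hv hw n a => ?_)
      (hsmul := fun r v hv n a => ?_) (eq_top_of_mul_mem _ ?_ (fun i h1 h2 v hv n a => ?_)
      (fun i h1 h2 v hv n a => ?_))
    · rw [map_zero, LinearMap.zero_apply, LinearMap.zero_apply, smul_zero]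
    · rw [map_add, LinearMap.add_apply, LinearMap.add_apply, smul_add, hv, hw]
    · rw [map_smul ψ, LinearMap.smul_apply, LinearMap.smul_apply, hv, PresBimod.scalar_right_smul]
    · intro n a
      rw [map_one, Module.End.one_apply, Module.End.one_apply]
    · have hv : ∀ (n : N) (a : Alg R lam laminv del z (m + 2)), ψ v (n <• a) = ψ v n <• a := hv
      rw [map_mul, Module.End.mul_apply, Module.End.mul_apply, hv]
      rcases Nat.lt_or_ge i (m + 2) with h | h
      · rw [(hψ i h1 h).1]
        exact (PresBimod.smul_right_smul _ _ _).symm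
      · obtain rfl : i = m + 2 := by lia
        rw [ψg, o.opG_right]
    · have hv : ∀ (n : N) (a : Alg R lam laminv del z (m + 2)), ψ v (n <• a) = ψ v n <• a := hv
      rw [map_mul, Module.End.mul_apply, Module.End.mul_apply, hv]
      rcases Nat.lt_or_ge i (m + 2) with h | h
      · rw [(hψ i h1 h).2.2]
        exact (PresBimod.smul_right_smul _ _ _).symm
      · obtain rfl : i = m + 2 := by lia
        rw [ψe, o.opE_right]
  refine Exists.elim (PresBimod.exists_lift (ι := incl hlam (m + 1))
    (gi := gi R lam laminv del z (m + 2) (m + 1)) (e := e R lam laminv del z (m + 2) (m + 1)) Q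
    (L.toLinearMap.flip x) (L.toLinearMap.flip y) (L.toLinearMap.flip w)
    (fun a b => ?_) (fun a b => ?_) (fun a b => ?_) (fun a => ?_) (fun a => ?_) fun a => ?_)
    fun F ⟨F_right, F_one, F_gen, F_cup⟩ => ?_
  any_goals simp only [LinearMap.flip_apply, AlgHom.toLinearMap_apply, map_mul,
    Module.End.mul_apply]
  · rw [hx, hcomm]
  · rw [hy, hcomm]
  · rw [hw, hcomm]
  · rw [← hcomm, hr, ← hcomm, ← hcomm]
  · rw [hl, ← hcomm, ← hcomm]
  · rw [← hb, ← hcomm, ← hcomm]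
  have F_left := PresBimod.lift_left hcomm F_right F_one F_gen F_cup
  refine ⟨F ∘ₗ ψ.toLinearMap.flip (PresBimod.one _ _ _), ?_, ?_, ?_, fun b v => ?_, fun v b => ?_⟩
  all_goals simp only [LinearMap.comp_apply, LinearMap.flip_apply, AlgHom.toLinearMap_apply,
      map_mul,
    Module.End.mul_apply]
  · have := F_one 1
    rw [one_smul] at this
    rw [map_one, Module.End.one_apply, this]
    simp
  · have h1 := F_gen 1
    have h2 := o.opG_one 1
    rw [one_smul] at h1
    rw [one_smul, MulOpposite.op_one, one_smul] at h2
    rw [ψg, h2, h1]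
    simp
  · have h1 := F_cup 1
    have h2 := o.opE_one 1
    rw [one_smul] at h1
    rw [one_smul, MulOpposite.op_one, one_smul] at h2
    rw [ψe, h2, h1]
    simp
  · rw [ψ_incl, F_left]
  · rw [ψ_incl, PresBimod.smul_one_eq, ψ_right, F_right]

end Step

section Base

variable {R : Type u} [CommRing R] {lam laminv del z : R}

theorem exists_algebraMap_eq {n : ℕ} (hn : n ≤ 1) (b : Alg R lam laminv del z n) :
    ∃ r : R, b = algebraMap R _ r := by
  refine pred_of_eq_top (R := R) (p := fun b : Alg R lam laminv del z n => ∃ r : R,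
      b = algebraMap R _ r)
    (h0 := ⟨0, by simp⟩)
    (hadd := by rintro x y ⟨r, rfl⟩ ⟨s, rfl⟩; exact ⟨r + s, by simp⟩)
    (hsmul := by rintro r x ⟨s, rfl⟩; exact ⟨r * s, by simp [Algebra.smul_def]⟩)
    (eq_top_of_mul_mem _ ⟨1, by simp⟩ (fun i h1 h2 => by lia) (fun i h1 h2 => by lia)) b

/-- The regular representation of `W_2` on the basis `1`, `g`, `e`. -/
theorem exists_regular_rep (hlam : lam * laminv = 1) (hskein : laminv - lam = z * (del - 1)) :
    ∃ ρ : Alg R lam laminv del z 2 →ₐ[R] Matrix (Fin 3) (Fin 3) R,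
      ρ (g R lam laminv del z 2 1) = !![0, 1, 0; 1, -z, 0; 0, z * laminv, laminv] ∧
      ρ (e R lam laminv del z 2 1) = !![0, 0, 0; 0, 0, 0; 1, laminv, del] := by
  have hs : Single lam laminv del z
      (!![0, 1, 0; 1, -z, 0; 0, z * laminv, laminv] : Matrix (Fin 3) (Fin 3) R)
      !![z, 1, 0; 1, 0, 0; -z, 0, lam] !![0, 0, 0; 0, 0, 0; 1, laminv, del] := by
    constructor
    all_goals
      ext i j
      fin_cases i <;> fin_cases j <;>
        simp [Matrix.mul_apply, Fin.sum_univ_three] <;> grind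
  have H : IsRep lam laminv del z 2
      (fun _ => (!![0, 1, 0; 1, -z, 0; 0, z * laminv, laminv] : Matrix (Fin 3) (Fin 3) R))
      (fun _ => !![z, 1, 0; 1, 0, 0; -z, 0, lam]) (fun _ => !![0, 0, 0; 0, 0, 0; 1, laminv, del]) :=
    ⟨fun _ _ _ => hs, fun i h1 h2 => by lia, fun i j h1 h2 h3 => by lia,
      fun i j h1 h2 h3 => by lia, fun i j h1 h2 h3 => by lia, fun i j h1 h2 h3 => by lia⟩
  obtain ⟨ρ, hρ⟩ := H.exists_algHom hlam
  exact ⟨ρ, (hρ 1 le_rfl (by lia)).1, (hρ 1 le_rfl (by lia)).2.2⟩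

theorem isUniversal_zero (hlam : lam * laminv = 1) (hskein : laminv - lam = z * (del - 1)) :
    IsUniversal (1 ≤ 0) (incl hlam 0) (incl hlam 1)
      (gi R lam laminv del z 1 0) (e R lam laminv del z 1 0)
      (g R lam laminv del z 2 1) (e R lam laminv del z 2 1) := by
  intro X _ _ L Q x y w _ _ _ _ _ _ _
  obtain ⟨ρ, hg, he⟩ := exists_regular_rep (R := R) (del := del) hlam hskein
  let entry (i : Fin 3) : Alg R lam laminv del z 2 →ₗ[R] R :=
    Matrix.entryLinearMap R R i 0 ∘ₗ ρ.toLinearMap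
  have entry_apply : ∀ i v, entry i v = ρ v i 0 := fun i v => rfl
  have scalar : ∀ (F : Alg R lam laminv del z 2 →ₗ[R] X) (b : Alg R lam laminv del z 1) v,
      F (incl hlam 1 b * v) = L b (F v) ∧ F (v * incl hlam 1 b) = Q (MulOpposite.op b) (F v) := by
    intro F b v
    obtain ⟨r, rfl⟩ := exists_algebraMap_eq le_rfl b
    constructor
    · rw [AlgHom.commutes, AlgHom.commutes, ← Algebra.smul_def, map_smul,
        Module.algebraMap_end_apply]
    · rw [AlgHom.commutes, ← MulOpposite.algebraMap_apply, AlgHom.commutes, ← Algebra.commutes,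
        ← Algebra.smul_def, map_smul, Module.algebraMap_end_apply]
  refine ⟨(entry 0).smulRight x + (entry 1).smulRight y + (entry 2).smulRight w, ?_, ?_, ?_,
    fun b v => (scalar _ b v).1, fun v b => (scalar _ b v).2⟩
  · simp [entry_apply]
  · simp [entry_apply, hg]
  · simp [entry_apply, he]

theorem tower (hlam : lam * laminv = 1) (hskein : laminv - lam = z * (del - 1)) (m : ℕ) :
    Tower lam laminv del z (1 ≤ m) (incl hlam m) (incl hlam (m + 1))
      (g R lam laminv del z (m + 1) m) (gi R lam laminv del z (m + 1) m)
      (e R lam laminv del z (m + 1) m) (g R lam laminv del z (m + 2) (m + 1))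
      (gi R lam laminv del z (m + 2) (m + 1)) (e R lam laminv del z (m + 2) (m + 1)) := by
  induction m with
  | zero => exact tower_of_isUniversal hlam hskein 0 (isUniversal_zero hlam hskein)
  | succ m ih => exact tower_of_isUniversal hlam hskein (m + 1) (isUniversal_succ hlam m ih)

end Base

section Expectation

variable {R C B A : Type u} [CommRing R] [Ring C] [Algebra R C] [Ring B] [Algebra R B] [Ring A]
  [Algebra R A]

/-- A unital bimodule map `E : A → B` with `E g = lam / del` and `E e = 1 / del`
(the latter two imposed only if `c` holds). -/
structure CondExp (lam delinv : R) (c : Prop) (ι : B →ₐ[R] A) (g e : A) (E : A →ₗ[R] B) :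
    Prop where
  left : ∀ b x, E (ι b * x) = b * E x
  right : ∀ x b, E (x * ι b) = E x * b
  one : E 1 = 1
  map_g : c → E g = (lam * delinv) • 1
  map_e : c → E e = delinv • 1

theorem CondExp.sandwich_left {lam delinv : R} {c : Prop} {ιC : C →ₐ[R] B} {ιB : B →ₐ[R] A}
    {g e : A} {E : A →ₗ[R] B} (hE : CondExp lam delinv c ιB g e E) {s s' : A}
    (hs : ∀ a, s * ιB (ιC a) = ιB (ιC a) * s) (a : C) (b : B) :
    E (s * ιB (ιC a * b) * s') = ιC a * E (s * ιB b * s') := by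
  rw [map_mul ιB, ← mul_assoc, hs, mul_assoc, mul_assoc, hE.left, ← mul_assoc]

theorem CondExp.sandwich_right {lam delinv : R} {c : Prop} {ιC : C →ₐ[R] B} {ιB : B →ₐ[R] A}
    {g e : A} {E : A →ₗ[R] B} (hE : CondExp lam delinv c ιB g e E) {s s' : A}
    (hs : ∀ a, s' * ιB (ιC a) = ιB (ιC a) * s') (b : B) (a : C) :
    E (s * ιB (b * ιC a) * s') = E (s * ιB b * s') * ιC a := by
  rw [map_mul ιB, mul_assoc, mul_assoc, ← hs, ← mul_assoc, ← mul_assoc, hE.right]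

theorem CondExp.apply_incl {lam delinv : R} {c : Prop} {ι : B →ₐ[R] A}
    {g e : A} {E : A →ₗ[R] B} (hE : CondExp lam delinv c ι g e E) (b : B) : E (ι b) = b := by
  simpa [hE.one] using hE.left b 1

namespace Tower

variable {lam laminv del delinv z : R} {c : Prop} {ιC : C →ₐ[R] B} {ιB : B →ₐ[R] A} {h hi f : B}
    {g gi e : A} (t : Tower lam laminv del z c ιC ιB h hi f g gi e)
include t

/-- Two `C`-bimodule maps on `B` agree if they agree on the generators of `B` as a bimodule. -/
theorem ext_bimod {X : Type u} [AddCommGroup X] [Module R X] {P Q : B →ₗ[R] X}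
    (h_left : ∀ a b, P b = Q b → P (ιC a * b) = Q (ιC a * b))
    (h_right : ∀ b a, P b = Q b → P (b * ιC a) = Q (b * ιC a))
    (h1 : P 1 = Q 1) (hh : c → P h = Q h) (hf : c → P f = Q f) (b : B) : P b = Q b := by
  have := t.genB (LinearMap.eqLocus P Q) h_left h_right h1 hh hf
  exact (this ▸ Submodule.mem_top : b ∈ LinearMap.eqLocus P Q)

variable {E : A →ₗ[R] B} (hE : CondExp lam delinv True ιB g e E) (hdel : del * delinv = 1)

theorem e_mul_e {E' : B →ₗ[R] C} (hE' : CondExp lam delinv c ιC h f E')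
    (hdel : del * delinv = 1) (b : B) : e * ιB b * e = del • (ιB (ιC (E' b)) * e) := by
  refine t.ext_bimod
    (P := LinearMap.mulRight R e ∘ₗ LinearMap.mulLeft R e ∘ₗ ιB.toLinearMap)
    (Q := del • LinearMap.mulRight R e ∘ₗ ιB.toLinearMap ∘ₗ ιC.toLinearMap ∘ₗ E')
    (fun a b hb => ?_) (fun b a hb => ?_) ?_ (fun hc => ?_) (fun hc => ?_) b
  · change e * ιB b * e = del • (ιB (ιC (E' b)) * e) at hb
    change e * ιB (ιC a * b) * e = del • (ιB (ιC (E' (ιC a * b))) * e)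
    rw [hE'.left, map_mul, map_mul, map_mul, ← mul_assoc, t.comm_e, mul_assoc, mul_assoc,
      ← mul_assoc e, hb, mul_smul_comm, mul_assoc]
  · change e * ιB b * e = del • (ιB (ιC (E' b)) * e) at hb
    change e * ιB (b * ιC a) * e = del • (ιB (ιC (E' (b * ιC a))) * e)
    rw [hE'.right, map_mul, map_mul, map_mul, mul_assoc, mul_assoc, ← t.comm_e, ← mul_assoc,
      ← mul_assoc, hb, smul_mul_assoc, mul_assoc, mul_assoc, t.comm_e]
  · change e * ιB 1 * e = del • (ιB (ιC (E' 1)) * e)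
    simp [hE'.one, t.singleA.e_e]
  · change e * ιB h * e = del • (ιB (ιC (E' h)) * e)
    rw [hE'.map_g hc, (t.pair hc).ehe]
    simp only [map_smul, map_one, smul_mul_assoc, one_mul, smul_smul]
    congr 1
    linear_combination -lam * hdel
  · change e * ιB f * e = del • (ιB (ιC (E' f)) * e)
    rw [hE'.map_e hc, (t.pair hc).efe]
    simp only [map_smul, map_one, smul_mul_assoc, one_mul, smul_smul, hdel, one_smul]

include hE

theorem condExp_sandwich_eq {s s' u u' : A} (hs : ∀ a, s * ιB (ιC a) = ιB (ιC a) * s)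
    (hs' : ∀ a, s' * ιB (ιC a) = ιB (ιC a) * s') (hu : ∀ a, u * ιB (ιC a) = ιB (ιC a) * u)
    (hu' : ∀ a, u' * ιB (ιC a) = ιB (ιC a) * u') (h1 : E (s * s') = E (u * u'))
    (hh : c → E (s * ιB h * s') = E (u * ιB h * u'))
    (hf : c → E (s * ιB f * s') = E (u * ιB f * u')) (b : B) :
    E (s * ιB b * s') = E (u * ιB b * u') := by
  refine t.ext_bimod
    (P := E ∘ₗ LinearMap.mulRight R s' ∘ₗ LinearMap.mulLeft R s ∘ₗ ιB.toLinearMap)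
    (Q := E ∘ₗ LinearMap.mulRight R u' ∘ₗ LinearMap.mulLeft R u ∘ₗ ιB.toLinearMap)
    (fun a b hb => ?_) (fun b a hb => ?_) ?_ hh hf b
  · change E (s * ιB b * s') = E (u * ιB b * u') at hb
    change E (s * ιB (ιC a * b) * s') = E (u * ιB (ιC a * b) * u')
    rw [hE.sandwich_left hs, hE.sandwich_left hu, hb]
  · change E (s * ιB b * s') = E (u * ιB b * u') at hb
    change E (s * ιB (b * ιC a) * s') = E (u * ιB (b * ιC a) * u')
    rw [hE.sandwich_right hs', hE.sandwich_right hu', hb]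
  · change E (s * ιB 1 * s') = E (u * ιB 1 * u')
    simpa using h1

theorem condExp_g_mul_e (b : B) : E (g * ιB b * e) = E (e * ιB b * g) := by
  refine t.condExp_sandwich_eq hE t.comm_g t.comm_e t.comm_e t.comm_g ?_ (fun hc => ?_)
    (fun hc => ?_) b
  · rw [t.singleA.g_e, t.singleA.e_g]
  · rw [(t.pair hc).ghe, (t.pair hc).ehg, hE.left, hE.right, hE.map_e trivial]
    simp
  · rw [(t.pair hc).gfe, (t.pair hc).efg, hE.left, hE.right, hE.map_e trivial]
    simp

include hdel in
theorem condExp_g_mul_gi (b : B) : E (g * ιB b * gi) = E (e * ιB b * e) := by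
  refine t.condExp_sandwich_eq hE t.comm_g t.gi_comm t.comm_e t.comm_e ?_ (fun hc => ?_)
    (fun hc => ?_) b
  · rw [t.singleA.g_gi, t.singleA.e_e, map_smul, hE.one, hE.map_e trivial, smul_smul, hdel,
      one_smul]
  · rw [(t.pair hc).ghgi, (t.pair hc).ehe, map_smul, hE.map_e trivial, hE.right, hE.left,
      hE.map_g trivial, mul_smul_comm, mul_one, smul_mul_assoc, (t.singleB hc).gi_g, smul_smul]
  · rw [(t.pair hc).gfgi, (t.pair hc).efe, hE.map_e trivial, hE.right, hE.left,
      hE.map_e trivial, mul_smul_comm, mul_one, smul_mul_assoc, (t.singleB hc).gi_g]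

omit hE

theorem adjoint {E' : B →ₗ[R] C} (hE' : CondExp lam delinv c ιC h f E') {τ : C →ₗ[R] R}
    (hτ : ∀ x y, τ (E' (x * y)) = τ (E' (y * x))) {φ : B →ₗ[R] B}
    (φ_left : ∀ a b, φ (ιC a * b) = ιC a * φ b) (φ_right : ∀ b a, φ (b * ιC a) = φ b * ιC a)
    (hφ : ∀ s s', (s = 1 ∨ c ∧ (s = h ∨ s = f)) → (s' = 1 ∨ c ∧ (s' = h ∨ s' = f)) →
      ∀ a, E' (φ s * ιC a * s') = E' (s * ιC a * φ s')) (x y : B) :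
    τ (E' (φ x * y)) = τ (E' (x * φ y)) := by
  have key : ∀ s, (s = 1 ∨ c ∧ (s = h ∨ s = f)) → ∀ y a a',
      τ (E' (φ s * ιC a * y * ιC a')) = τ (E' (s * ιC a * φ y * ιC a')) := by
    intro s hs
    have base : ∀ s', (s' = 1 ∨ c ∧ (s' = h ∨ s' = f)) → ∀ a a',
        τ (E' (φ s * ιC a * s' * ιC a')) = τ (E' (s * ιC a * φ s' * ιC a')) := by
      intro s' hs' a a'
      rw [hE'.right, hE'.right, hφ s s' hs hs']
    refine pred_of_eq_top (R := R) (h0 := by simp) (hadd := fun y y' hy hy' a a' => ?_)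
      (hsmul := fun r y hy a a' => ?_) (t.genB _ ?_ ?_ (base 1 (by simp))
        (fun hc => base h (by simp [hc])) (fun hc => base f (by simp [hc])))
    · simp only [map_add, mul_add, add_mul, hy, hy']
    · simp only [map_smul, mul_smul_comm, smul_mul_assoc, hy]
    · intro b y hy a a'
      have := hy (a * b) a'
      simpa only [φ_left, map_mul, mul_assoc] using this
    · intro y b hy a a'
      have := hy a (b * a')
      simpa only [φ_right, map_mul, mul_assoc] using this
  have main : ∀ x y a a', τ (E' (φ x * ιC a * y * ιC a')) = τ (E' (x * ιC a * φ y * ιC a')) := by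
    refine pred_of_eq_top (R := R) (h0 := by simp) (hadd := fun y y' hy hy' y a a' => ?_)
      (hsmul := fun r y hy y a a' => ?_) (t.genB _ ?_ ?_ (key 1 (by simp))
        (fun hc => key h (by simp [hc])) (fun hc => key f (by simp [hc])))
    · simp only [map_add, add_mul, hy, hy']
    · simp only [map_smul, smul_mul_assoc, hy]
    · intro b x hx y a a'
      have := hx y a (a' * b)
      rw [φ_left, mul_assoc, mul_assoc, mul_assoc, hτ, mul_assoc (ιC b) x, mul_assoc (ιC b),
        mul_assoc (ιC b), hτ (ιC b)]
      simpa only [map_mul, mul_assoc] using this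
    · intro x b hx y a a'
      have := hx y (b * a) a'
      simpa only [φ_right, map_mul, mul_assoc] using this
  simpa using main x y 1 1

end Tower

end Expectation

section TraceProperty

variable {R C B A : Type u} [CommRing R] [Ring C] [Algebra R C] [Ring B] [Algebra R B] [Ring A]
  [Algebra R A]

/-- The symmetry properties of the conditional expectation `E` sandwiched between generators. -/
structure SandwichSymm (ι : B →ₐ[R] A) (g gi e : A) (E : A →ₗ[R] B) : Prop where
  g_e : ∀ b, E (g * ι b * e) = E (e * ι b * g)
  g_gi : ∀ b, E (g * ι b * gi) = E (e * ι b * e)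
  gi_g : ∀ b, E (gi * ι b * g) = E (e * ι b * e)
  gi_e : ∀ b, E (gi * ι b * e) = E (e * ι b * gi)

variable {lam laminv del delinv z : R} {c : Prop} {ιC : C →ₐ[R] B} {ιB : B →ₐ[R] A} {h hi f : B}
    {g gi e : A}

theorem SandwichSymm.mk' {E : A →ₗ[R] B} (s : Single lam laminv del z g gi e)
    (hge : ∀ b, E (g * ιB b * e) = E (e * ιB b * g))
    (hgi : ∀ b, E (g * ιB b * gi) = E (e * ιB b * e))
    (hg : ∀ b, E (g * ιB b) = E (ιB b * g)) (he : ∀ b, E (e * ιB b) = E (ιB b * e)) :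
    SandwichSymm ιB g gi e E := by
  refine ⟨hge, hgi, fun b => ?_, fun b => ?_⟩
  · rw [← hgi, s.gi_eq]
    simp only [add_mul, sub_mul, mul_add, mul_sub, smul_mul_assoc, mul_smul_comm, one_mul, mul_one,
      map_add, map_sub, map_smul, hge, hg]
  · rw [s.gi_eq]
    simp only [add_mul, sub_mul, mul_add, mul_sub, smul_mul_assoc, mul_smul_comm, one_mul, mul_one,
      map_add, map_sub, map_smul, hge, he]

namespace CondExp

variable {E' : B →ₗ[R] C} (hE' : CondExp lam delinv c ιC h f E')
include hE'

theorem incl_mul_g (hc : c) (a : C) : E' (ιC a * h) = (lam * delinv) • a := by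
  rw [hE'.left, hE'.map_g hc, mul_smul_comm, mul_one]

theorem g_mul_incl (hc : c) (a : C) : E' (h * ιC a) = (lam * delinv) • a := by
  rw [hE'.right, hE'.map_g hc, smul_mul_assoc, one_mul]

theorem incl_mul_e (hc : c) (a : C) : E' (ιC a * f) = delinv • a := by
  rw [hE'.left, hE'.map_e hc, mul_smul_comm, mul_one]

theorem e_mul_incl (hc : c) (a : C) : E' (f * ιC a) = delinv • a := by
  rw [hE'.right, hE'.map_e hc, smul_mul_assoc, one_mul]

theorem map_gi (s : Single lam laminv del z h hi f) (hdel : del * delinv = 1)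
    (hskein : laminv - lam = z * (del - 1)) (hc : c) : E' hi = (laminv * delinv) • 1 := by
  rw [s.gi_eq, map_add, map_sub, map_smul, map_smul, hE'.map_g hc, hE'.map_e hc, hE'.one]
  linear_combination (norm := module) (-delinv * hskein - z * hdel) • (1 : C)

theorem incl_mul_gi (s : Single lam laminv del z h hi f) (hdel : del * delinv = 1)
    (hskein : laminv - lam = z * (del - 1)) (hc : c) (a : C) :
    E' (ιC a * hi) = (laminv * delinv) • a := by
  rw [hE'.left, hE'.map_gi s hdel hskein hc, mul_smul_comm, mul_one]

theorem gi_mul_incl (s : Single lam laminv del z h hi f) (hdel : del * delinv = 1)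
    (hskein : laminv - lam = z * (del - 1)) (hc : c) (a : C) :
    E' (hi * ιC a) = (laminv * delinv) • a := by
  rw [hE'.right, hE'.map_gi s hdel hskein hc, smul_mul_assoc, one_mul]

end CondExp

namespace Tower

variable (t : Tower lam laminv del z c ιC ιB h hi f g gi e) {E : A →ₗ[R] B}
  (hE : CondExp lam delinv True ιB g e E) (hdel : del * delinv = 1)
include t hE hdel

theorem sandwichSymm : SandwichSymm ιB g gi e E :=
  .mk' t.singleA (t.condExp_g_mul_e hE) (t.condExp_g_mul_gi hE hdel)
    (fun b => by rw [hE.g_mul_incl trivial, hE.incl_mul_g trivial])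
    (fun b => by rw [hE.e_mul_incl trivial, hE.incl_mul_e trivial])

variable {E' : B →ₗ[R] C} (hE' : CondExp lam delinv c ιC h f E')
  (hS : c → SandwichSymm ιC h hi f E') {τ : C →ₗ[R] R}
  (hτ : ∀ x y, τ (E' (x * y)) = τ (E' (y * x)))
include hE' hS hτ

theorem adjoint_g_g (x y : B) :
    τ (E' (E (g * ιB x * g) * y)) = τ (E' (x * E (g * ιB y * g))) := by
  refine t.adjoint hE' hτ (φ := E ∘ₗ LinearMap.mulRight R g ∘ₗ LinearMap.mulLeft R g ∘ₗ
    ιB.toLinearMap) (fun a b => hE.sandwich_left t.comm_g a b)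
    (fun b a => hE.sandwich_right t.comm_g b a) (fun s s' hs hs' a => ?_) x y
  change E' (E (g * ιB s * g) * ιC a * s') = E' (s * ιC a * E (g * ιB s' * g))
  have r1 : E (g * ιB 1 * g) = (1 + z * laminv * delinv - z * (lam * delinv)) • 1 := by
    rw [map_one, mul_one, t.singleA.g_g, map_sub, map_add, map_smul, map_smul, hE.map_e trivial,
      hE.map_g trivial, hE.one]
    module
  by_cases hc : c
  · have s := t.singleB hc
    have P := t.pair hc
    have S := hS hc
    have rh : E (g * ιB h * g) = (lam * delinv) • (1 + (z * laminv) • f - z • h) := by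
      rw [P.braid, hE.right, hE.left, hE.map_g trivial, mul_smul_comm, mul_one, smul_mul_assoc,
        s.g_g]
    have rf : E (g * ιB f * g) = delinv • (1 - (z * lam) • f + z • hi) := by
      rw [P.gfg, hE.right, hE.left, hE.map_e trivial, mul_smul_comm, mul_one, smul_mul_assoc,
        s.gi_gi t.hlam]
    have k : (delinv * z * (lam * laminv)) • E' (f * ιC a * f) = (delinv * z) • E' (f * ιC a *
        f) := by
      rw [t.hlam, mul_one]
    rcases hs with rfl | ⟨-, rfl | rfl⟩ <;> rcases hs' with rfl | ⟨-, rfl | rfl⟩ <;>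
      simp only [r1, rh, rf, add_mul, sub_mul, mul_add, mul_sub, smul_mul_assoc, mul_smul_comm,
        one_mul, mul_one, map_add, map_sub, map_smul, hE'.incl_mul_g hc, hE'.g_mul_incl hc,
        hE'.incl_mul_e hc, hE'.e_mul_incl hc, hE'.incl_mul_gi s hdel t.hskein hc,
        hE'.gi_mul_incl s hdel t.hskein hc, S.g_e, S.g_gi,
        S.gi_g, S.gi_e, hE'.apply_incl]
    all_goals first
      | module
      | linear_combination (norm := module) k
      | linear_combination (norm := module) -k
  · obtain rfl : s = 1 := by tauto
    obtain rfl : s' = 1 := by tauto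
    rw [r1]
    simp

theorem adjoint_g_e (x y : B) :
    τ (E' (E (g * ιB x * e) * y)) = τ (E' (x * E (g * ιB y * e))) := by
  refine t.adjoint hE' hτ (φ := E ∘ₗ LinearMap.mulRight R e ∘ₗ LinearMap.mulLeft R g ∘ₗ
    ιB.toLinearMap) (fun a b => hE.sandwich_left t.comm_g a b)
    (fun b a => hE.sandwich_right t.comm_e b a) (fun s s' hs hs' a => ?_) x y
  change E' (E (g * ιB s * e) * ιC a * s') = E' (s * ιC a * E (g * ιB s' * e))
  have r1 : E (g * ιB 1 * e) = (laminv * delinv) • 1 := by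
    rw [map_one, mul_one, t.singleA.g_e, map_smul, hE.map_e trivial, smul_smul]
  by_cases hc : c
  · have s := t.singleB hc
    have P := t.pair hc
    have S := hS hc
    have rh : E (g * ιB h * e) = delinv • f := by
      rw [P.ghe, hE.left, hE.map_e trivial, mul_smul_comm, mul_one]
    have rf : E (g * ιB f * e) = delinv • hi := by
      rw [P.gfe, hE.left, hE.map_e trivial, mul_smul_comm, mul_one]
    have k : (delinv * delinv * (lam * laminv)) • a = (delinv * delinv) • a := by
      rw [t.hlam, mul_one]
    rcases hs with rfl | ⟨-, rfl | rfl⟩ <;> rcases hs' with rfl | ⟨-, rfl | rfl⟩ <;>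
      simp only [r1, rh, rf, smul_mul_assoc, mul_smul_comm,
        one_mul, mul_one, map_smul, hE'.incl_mul_g hc, hE'.g_mul_incl hc,
        hE'.incl_mul_e hc, hE'.e_mul_incl hc, hE'.incl_mul_gi s hdel t.hskein hc,
        hE'.gi_mul_incl s hdel t.hskein hc, S.g_e, S.g_gi,
        S.gi_g, S.gi_e, hE'.apply_incl]
    all_goals first
      | module
      | linear_combination (norm := module) k
      | linear_combination (norm := module) -k
  · obtain rfl : s = 1 := by tauto
    obtain rfl : s' = 1 := by tauto
    rw [r1]
    simp

omit hS hτ in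
theorem adjoint_e_e (x y : B) :
    τ (E' (E (e * ιB x * e) * y)) = τ (E' (x * E (e * ιB y * e))) := by
  have key : ∀ b, E (e * ιB b * e) = ιC (E' b) := fun b => by
    rw [t.e_mul_e hE' hdel, map_smul, hE.incl_mul_e trivial, smul_smul, hdel, one_smul]
  rw [key, key, hE'.left, hE'.right]

omit hdel hE' hS hτ in
/-- An element adjoint to the generators of `A` as a `B`-bimodule is central for the trace. -/
theorem trace_mul_comm_of_adjoint {x : A} {r : R} (hx : E x = r • 1)
    (hg : ∀ a b, τ (E' (E (x * ιB a * g) * b)) = τ (E' (a * E (g * ιB b * x))))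
    (he : ∀ a b, τ (E' (E (x * ιB a * e) * b)) = τ (E' (a * E (e * ιB b * x)))) (y : A) :
    τ (E' (E (x * y))) = τ (E' (E (y * x))) := by
  have base : ∀ s, (∀ a b, τ (E' (E (x * ιB a * s) * b)) = τ (E' (a * E (s * ιB b * x)))) →
      ∀ a b, τ (E' (E (x * (ιB a * s * ιB b)))) = τ (E' (E (ιB a * s * ιB b * x))) := by
    intro s hs a b
    have := hs a b
    rwa [← hE.right, ← hE.left, ← mul_assoc, ← mul_assoc, mul_assoc x, mul_assoc x] at this
  refine t.induct (p := fun y => ∀ a b, τ (E' (E (x * (ιB a * y * ιB b)))) =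
    τ (E' (E (ιB a * y * ιB b * x)))) (by simp) (fun y y' hy hy' a b => ?_) (fun r y hy a b => ?_)
    (fun b y hy a b' => ?_) (fun y b hy a b' => ?_) (fun a b => ?_) (base g hg) (base e he) y 1 1 |>
    fun hy => by simpa using hy
  · simp only [mul_add, add_mul, map_add, hy, hy']
  · simp only [mul_smul_comm, smul_mul_assoc, map_smul, hy]
  · rw [← mul_assoc (ιB a), ← map_mul]
    exact hy _ _
  · rw [← mul_assoc (ιB a), mul_assoc _ (ιB b), ← map_mul]
    exact hy _ _
  · rw [mul_one, ← map_mul, hE.right, hE.left, hx, smul_mul_assoc, mul_smul_comm, one_mul, mul_one]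

theorem trace_g_mul (y : A) : τ (E' (E (g * y))) = τ (E' (E (y * g))) :=
  t.trace_mul_comm_of_adjoint hE (hE.map_g trivial) (t.adjoint_g_g hE hdel hE' hS hτ)
    (fun a b => by rw [t.adjoint_g_e hE hdel hE' hS hτ, t.condExp_g_mul_e hE]) y

theorem trace_e_mul (y : A) : τ (E' (E (e * y))) = τ (E' (E (y * e))) :=
  t.trace_mul_comm_of_adjoint hE (hE.map_e trivial)
    (fun a b => by rw [← t.condExp_g_mul_e hE, t.adjoint_g_e hE hdel hE' hS hτ])
    (t.adjoint_e_e hE hdel hE') y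

end Tower

end TraceProperty

section Construction

variable {R : Type u} [CommRing R] {lam laminv del delinv z : R}

theorem CondExp.congr_prop {B A : Type u} [Ring B] [Algebra R B] [Ring A] [Algebra R A]
    {c c' : Prop} {ι : B →ₐ[R] A} {g e : A} {E : A →ₗ[R] B} (hE : CondExp lam delinv c ι g e E)
    (hc : c' → c) : CondExp lam delinv c' ι g e E :=
  ⟨hE.left, hE.right, hE.one, fun h => hE.map_g (hc h), fun h => hE.map_e (hc h)⟩

theorem exists_scalar_algHom (hlam : lam * laminv = 1) {n : ℕ} (hn : n ≤ 1) (S : Type u) [Ring S]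
    [Algebra R S] : Nonempty (Alg R lam laminv del z n →ₐ[R] S) := by
  have H : IsRep lam laminv del z n (fun _ => (1 : S)) (fun _ => 1) (fun _ => 1) :=
    ⟨fun i h1 h2 => by lia, fun i h1 h2 => by lia, fun i j h1 h2 h3 => by lia,
      fun i j h1 h2 h3 => by lia, fun i j h1 h2 h3 => by lia, fun i j h1 h2 h3 => by lia⟩
  exact (H.exists_algHom hlam).nonempty

theorem exists_condExp (hlam : lam * laminv = 1) (hdel : del * delinv = 1)
    (hskein : laminv - lam = z * (del - 1)) (m : ℕ) :
    ∃ E : Alg R lam laminv del z (m + 1) →ₗ[R] Alg R lam laminv del z m,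
      CondExp lam delinv (1 ≤ m) (incl hlam m) (g R lam laminv del z (m + 1) m)
        (e R lam laminv del z (m + 1) m) E ∧
      (1 ≤ m → SandwichSymm (incl hlam m) (g R lam laminv del z (m + 1) m)
        (gi R lam laminv del z (m + 1) m) (e R lam laminv del z (m + 1) m) E) := by
  cases m with
  | zero =>
    obtain ⟨φ⟩ := exists_scalar_algHom (del := del) (z := z) hlam le_rfl
      (Alg R lam laminv del z 0)
    have hφ : ∀ b, φ (incl hlam 0 b) = b := fun b => by
      obtain ⟨r, rfl⟩ := exists_algebraMap_eq zero_le_one b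
      rw [AlgHom.commutes, AlgHom.commutes]
    refine ⟨φ.toLinearMap, ⟨fun b x => ?_, fun x b => ?_, map_one φ, fun h => by lia,
      fun h => by lia⟩, fun h => by lia⟩
    · exact (map_mul φ _ _).trans (by rw [hφ]; rfl)
    · exact (map_mul φ _ _).trans (by rw [hφ]; rfl)
  | succ k =>
    have t := tower (R := R) (del := del) (z := z) hlam hskein k
    obtain ⟨K, K1, Kg, Ke, Kl, Kr⟩ := t.exists_contraction
    have hE : CondExp lam delinv True (incl hlam (k + 1)) (g R lam laminv del z (k + 2) (k + 1))
        (e R lam laminv del z (k + 2) (k + 1)) (delinv • K) :=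
      ⟨fun b x => by rw [LinearMap.smul_apply, LinearMap.smul_apply, Kl, mul_smul_comm],
        fun x b => by rw [LinearMap.smul_apply, LinearMap.smul_apply, Kr, smul_mul_assoc],
        by rw [LinearMap.smul_apply, K1, smul_smul, mul_comm, hdel, one_smul],
        fun _ => by rw [LinearMap.smul_apply, Kg, smul_smul, mul_comm],
        fun _ => by rw [LinearMap.smul_apply, Ke]⟩
    exact ⟨delinv • K, hE.congr_prop fun _ => trivial, fun _ => t.sandwichSymm hE hdel⟩

/-- A linear functional on `W_n` is a trace if every generator is central for it. -/
theorem trace_of_generators {n : ℕ} {M : Type*} [AddCommGroup M] [Module R M]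
    (τ : Alg R lam laminv del z n →ₗ[R] M)
    (hg : ∀ i, 1 ≤ i → i < n → ∀ y, τ (g R lam laminv del z n i * y) =
      τ (y * g R lam laminv del z n i))
    (he : ∀ i, 1 ≤ i → i < n → ∀ y, τ (e R lam laminv del z n i * y) =
      τ (y * e R lam laminv del z n i)) (x y : Alg R lam laminv del z n) :
    τ (x * y) = τ (y * x) := by
  have mul : ∀ s, (∀ y, τ (s * y) = τ (y * s)) → ∀ x, (∀ y, τ (x * y) = τ (y * x)) →
      ∀ y, τ (s * x * y) = τ (y * (s * x)) := by
    intro s hs x hx y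
    rw [mul_assoc, hs, mul_assoc, hx, mul_assoc]
  exact pred_of_eq_top (R := R) (p := fun x => ∀ y, τ (x * y) = τ (y * x)) (h0 := by simp)
    (hadd := fun x x' hx hx' y => by rw [add_mul, mul_add, map_add, map_add, hx, hx'])
    (hsmul := fun r x hx y => by rw [smul_mul_assoc, mul_smul_comm, map_smul, map_smul, hx])
    (eq_top_of_mul_mem _ (fun y => by rw [one_mul, mul_one])
      (fun i h1 h2 x hx => mul _ (hg i h1 h2) x hx) (fun i h1 h2 x hx => mul _
        (he i h1 h2) x hx)) x y

/-- The iterated conditional expectation `W_m → W_0 → R`. -/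
noncomputable def iteratedExp
    (E : ∀ m, Alg R lam laminv del z (m + 1) →ₗ[R] Alg R lam laminv del z m)
    (ε : Alg R lam laminv del z 0 →ₗ[R] R) : ∀ m, Alg R lam laminv del z m →ₗ[R] R
  | 0 => ε
  | m + 1 => iteratedExp E ε m ∘ₗ E m

theorem iteratedExp_mul_comm (hlam : lam * laminv = 1) (hdel : del * delinv = 1)
    (hskein : laminv - lam = z * (del - 1))
    {E : ∀ m, Alg R lam laminv del z (m + 1) →ₗ[R] Alg R lam laminv del z m}
    (hE : ∀ m, CondExp lam delinv (1 ≤ m) (incl hlam m) (g R lam laminv del z (m + 1) m)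
        (e R lam laminv del z (m + 1) m) (E m))
    (hS : ∀ m, 1 ≤ m → SandwichSymm (incl hlam m) (g R lam laminv del z (m + 1) m)
        (gi R lam laminv del z (m + 1) m) (e R lam laminv del z (m + 1) m) (E m))
    (ε : Alg R lam laminv del z 0 →ₗ[R] R) (m : ℕ) (x y : Alg R lam laminv del z m) :
    iteratedExp E ε m (x * y) = iteratedExp E ε m (y * x) := by
  induction m with
  | zero =>
    obtain ⟨r, rfl⟩ := exists_algebraMap_eq zero_le_one x
    rw [Algebra.commutes]
  | succ m ih =>
    cases m with
    | zero =>
      obtain ⟨r, rfl⟩ := exists_algebraMap_eq le_rfl x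
      rw [Algebra.commutes]
    | succ m =>
      have t := tower (R := R) (del := del) (z := z) hlam hskein m
      have hE₁ : CondExp lam delinv True (incl hlam (m + 1))
          (g R lam laminv del z (m + 2) (m + 1)) (e R lam laminv del z (m + 2) (m + 1))
          (E (m + 1)) := (hE (m + 1)).congr_prop fun _ => by lia
      have old : ∀ (b : Alg R lam laminv del z (m + 1)) y,
          iteratedExp E ε (m + 2) (incl hlam (m + 1) b * y) =
            iteratedExp E ε (m + 2) (y * incl hlam (m + 1) b) := fun b y => by
        change iteratedExp E ε (m + 1) (E (m + 1) _) = iteratedExp E ε (m + 1) (E (m + 1) _)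
        rw [hE₁.left, hE₁.right, ih]
      refine trace_of_generators _ (fun i h1 h2 y => ?_) (fun i h1 h2 y => ?_) x y
      · rcases Nat.lt_or_eq_of_le (Nat.le_of_lt_succ h2) with h | rfl
        · rw [← (incl_spec hlam (m + 1) i h1 h).1, old]
        · exact t.trace_g_mul hE₁ hdel (hE m) (hS m) ih y
      · rcases Nat.lt_or_eq_of_le (Nat.le_of_lt_succ h2) with h | rfl
        · rw [← (incl_spec hlam (m + 1) i h1 h).2.2, old]
        · exact t.trace_e_mul hE₁ hdel (hE m) (hS m) ih y

end Construction

end BasicConstruction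

end BMW

namespace BMW

/-- For every `n ≥ 1` there are `R`-linear maps
`ε_n : W_{n,R} → W_{n-1,R}` and `ε : W_{n,R} → R` with properties (i)–(v)
(conditional expectation, `ε_n ∘ ι = id`, `e_n ι(x) e_n = δ ι'(ε_n(x)) e_n`, trace property,
compatibility of the traces).  Here (writing `m = n - 1`) the maps are organized as families
`E m : W_{m+1,R} → W_{m,R}` and `tr m : W_{m,R} → R`, and `ι` denotes the canonical
homomorphism `W_{m,R} → W_{m+1,R}` with `g_i ↦ g_i`, `g_i⁻¹ ↦ g_i⁻¹`, `e_i ↦ e_i`. -/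
theorem conditionalExpectation_and_trace
    (R : Type*) [CommRing R] (lam laminv del delinv z : R)
    (hlam : lam * laminv = 1) (hdel : del * delinv = 1)
    (hskein : laminv - lam = z * (del - 1)) :
    ∃ ι : ∀ m : ℕ, Alg R lam laminv del z m →ₐ[R] Alg R lam laminv del z (m + 1),
      (∀ (m i : ℕ), 1 ≤ i → i < m →
          ι m (g R lam laminv del z m i) = g R lam laminv del z (m + 1) i ∧
          ι m (gi R lam laminv del z m i) = gi R lam laminv del z (m + 1) i ∧
          ι m (e R lam laminv del z m i) = e R lam laminv del z (m + 1) i) ∧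
      ∃ (E : ∀ m : ℕ, Alg R lam laminv del z (m + 1) →ₗ[R] Alg R lam laminv del z m)
        (tr : ∀ m : ℕ, Alg R lam laminv del z m →ₗ[R] R),
        -- (i) `ε_n` is a `W_{n-1}`-`W_{n-1}`-bimodule map
        (∀ (m : ℕ) (a b : Alg R lam laminv del z m) (x : Alg R lam laminv del z (m + 1)),
          E m (ι m a * x * ι m b) = a * E m x * b) ∧
        -- (ii) `ε_n ∘ ι = id`, so `ι` is injective
        (∀ (m : ℕ) (a : Alg R lam laminv del z m), E m (ι m a) = a) ∧
        (∀ m : ℕ, Function.Injective (ι m)) ∧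
        -- (iii) `e_n ι(x) e_n = δ ι'(ε_n(x)) e_n` in `W_{n+1}`
        (∀ (m : ℕ) (x : Alg R lam laminv del z (m + 1)),
          e R lam laminv del z (m + 2) (m + 1) * ι (m + 1) x *
              e R lam laminv del z (m + 2) (m + 1) =
            del • (ι (m + 1) (ι m (E m x)) * e R lam laminv del z (m + 2) (m + 1))) ∧
        -- (iv) `ε` is a normalized trace
        (∀ (m : ℕ) (x y : Alg R lam laminv del z m), tr m (x * y) = tr m (y * x)) ∧
        (∀ m : ℕ, tr m 1 = 1) ∧
        -- (v) the traces are compatible with the inclusions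
        (∀ (m : ℕ) (x : Alg R lam laminv del z m), tr (m + 1) (ι m x) = tr m x) := by
  choose E hE hS using exists_condExp (R := R) (z := z) hlam hdel hskein
  obtain ⟨ε⟩ := exists_scalar_algHom (R := R) (del := del) (z := z) hlam zero_le_one R
  refine ⟨incl hlam, incl_spec hlam, E, iteratedExp E ε.toLinearMap,
    fun m a b x => by rw [(hE m).right, (hE m).left], fun m => (hE m).apply_incl,
    fun m => Function.LeftInverse.injective (hE m).apply_incl,
    fun m x => (tower hlam hskein m).e_mul_e (hE m) hdel x,
    iteratedExp_mul_comm hlam hdel hskein hE hS _, fun m => ?_,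
    fun m x => congrArg (iteratedExp E ε.toLinearMap m) ((hE m).apply_incl x)⟩
  induction m with
  | zero => exact map_one ε
  | succ m ih => exact (congrArg _ (hE m).one).trans ih

end BMW
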